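/- Let A be a smooth semilattice free finite idempotent algebra that omits type 1. Then any two elements a,b of A are connected by a directed path a = c_0, c_1, ..., c_k = b in which every consecutive pair c_i c_{i+1} is a thin affine edge or a thin majority edge of A. -/

import Mathlib

/-! Common framework: universal algebras over a fixed signature, terms,
subalgebras, congruences, quotients, edges and their types (Bulatov's
coloured-graph approach), thin edges, connectivity, products, etc. -/

/-- A (functional) signature: a type of operation symbols with arities. -/
structure Signature where
  ops : Type
  arity : ops → ℕ

/-- An algebra of a given signature. -/
structure UAlgebra (σ : Signature) where
  carrier : Type
  interp : ∀ f : σ.ops, (Fin (σ.arity f) → carrier) → carrier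

/-- Terms over the signature `σ` in `n` variables. -/
inductive Term (σ : Signature) (n : ℕ) where
  | var : Fin n → Term σ n
  | app : (f : σ.ops) → (Fin (σ.arity f) → Term σ n) → Term σ n

/-- Evaluation of a term in an algebra; term operations of an algebra are
exactly the operations of the form `Term.eval A t`. -/
def Term.eval {σ : Signature} {n : ℕ} (A : UAlgebra σ) :
    Term σ n → (Fin n → A.carrier) → A.carrier
  | .var i, x => x i
  | .app f ts, x => A.interp f fun j => Term.eval A (ts j) x

namespace UAlgebra

variable {σ : Signature}

/-- An algebra is idempotent if all its basic operations are. -/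
def Idempotent (A : UAlgebra σ) : Prop :=
  ∀ (f : σ.ops) (a : A.carrier), A.interp f (fun _ => a) = a

/-- A set closed under all basic operations. -/
def IsClosed (A : UAlgebra σ) (S : Set A.carrier) : Prop :=
  ∀ (f : σ.ops) (x : Fin (σ.arity f) → A.carrier), (∀ j, x j ∈ S) → A.interp f x ∈ S

/-- Closure of a set under the basic operations. -/
inductive Closure (A : UAlgebra σ) (S : Set A.carrier) : A.carrier → Prop
  | base {a : A.carrier} : a ∈ S → Closure A S a
  | app (f : σ.ops) (x : Fin (σ.arity f) → A.carrier) :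
      (∀ j, Closure A S (x j)) → Closure A S (A.interp f x)

def ClosureSet (A : UAlgebra σ) (S : Set A.carrier) : Set A.carrier := {x | Closure A S x}

theorem closureSet_isClosed (A : UAlgebra σ) (S : Set A.carrier) :
    A.IsClosed (A.ClosureSet S) := fun f x h => Closure.app f x h

/-- The subalgebra of `A` on a closed subset `S`. -/
def subalg (A : UAlgebra σ) (S : Set A.carrier) (hS : A.IsClosed S) : UAlgebra σ where
  carrier := {x : A.carrier // x ∈ S}
  interp f x := ⟨A.interp f fun j => (x j : A.carrier), hS f _ fun j => (x j).2⟩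

/-- The subalgebra generated by a set `S`. -/
def Sg (A : UAlgebra σ) (S : Set A.carrier) : UAlgebra σ :=
  A.subalg (A.ClosureSet S) (A.closureSet_isClosed S)

/-- `a` as an element of `Sg {a, b}`. -/
def sgA (A : UAlgebra σ) (a b : A.carrier) : (A.Sg {a, b}).carrier :=
  ⟨a, Closure.base (Set.mem_insert a {b})⟩

/-- `b` as an element of `Sg {a, b}`. -/
def sgB (A : UAlgebra σ) (a b : A.carrier) : (A.Sg {a, b}).carrier :=
  ⟨b, Closure.base (Set.mem_insert_iff.mpr (Or.inr rfl))⟩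

/-- A congruence of an algebra. -/
structure Congruence (A : UAlgebra σ) where
  rel : A.carrier → A.carrier → Prop
  refl : ∀ x, rel x x
  symm : ∀ {x y}, rel x y → rel y x
  trans : ∀ {x y z}, rel x y → rel y z → rel x z
  compat : ∀ (f : σ.ops) (x y : Fin (σ.arity f) → A.carrier),
      (∀ j, rel (x j) (y j)) → rel (A.interp f x) (A.interp f y)

def Congruence.toSetoid {A : UAlgebra σ} (θ : Congruence A) : Setoid A.carrier :=
  ⟨θ.rel, ⟨θ.refl, θ.symm, θ.trans⟩⟩

/-- The full congruence. -/
def Congruence.IsFull {A : UAlgebra σ} (θ : Congruence A) : Prop := ∀ x y, θ.rel x y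

def Congruence.le {A : UAlgebra σ} (θ η : Congruence A) : Prop :=
  ∀ x y, θ.rel x y → η.rel x y

/-- A maximal congruence: proper, and any congruence above it is full or below it. -/
def Congruence.IsMaximal {A : UAlgebra σ} (θ : Congruence A) : Prop :=
  ¬ θ.IsFull ∧ ∀ η : Congruence A, θ.le η → ¬ η.IsFull → η.le θ

/-- The quotient (factor) algebra. -/
noncomputable def quot (A : UAlgebra σ) (θ : Congruence A) : UAlgebra σ where
  carrier := Quotient θ.toSetoid
  interp f x := Quotient.mk θ.toSetoid (A.interp f fun j => (x j).out)

/-- The class of `a` in the quotient of `Sg {a,b}` by `θ`. -/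
def qa (A : UAlgebra σ) (a b : A.carrier) (θ : Congruence (A.Sg {a, b})) :
    ((A.Sg {a, b}).quot θ).carrier :=
  Quotient.mk θ.toSetoid (A.sgA a b)

def qb (A : UAlgebra σ) (a b : A.carrier) (θ : Congruence (A.Sg {a, b})) :
    ((A.Sg {a, b}).quot θ).carrier :=
  Quotient.mk θ.toSetoid (A.sgB a b)

end UAlgebra

/-- A binary operation is a semilattice operation on a set `B`. -/
def IsSemilatticeOn {α : Type} (f : α → α → α) (B : Set α) : Prop :=
  (∀ x ∈ B, f x x = x) ∧ (∀ x ∈ B, ∀ y ∈ B, f x y = f y x) ∧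
    (∀ x ∈ B, ∀ y ∈ B, ∀ z ∈ B, f x (f y z) = f (f x y) z)

/-- A ternary operation is a majority operation on a set `B`. -/
def IsMajorityOn {α : Type} (g : α → α → α → α) (B : Set α) : Prop :=
  ∀ x ∈ B, ∀ y ∈ B, g x x y = x ∧ g x y x = x ∧ g y x x = x

/-- A ternary operation is a Mal'tsev operation on a set `B`. -/
def IsMaltsevOn {α : Type} (h : α → α → α → α) (B : Set α) : Prop :=
  ∀ x ∈ B, ∀ y ∈ B, h x y y = x ∧ h y y x = x

namespace UAlgebra

variable {σ : Signature}

/-- An algebra is "a set": every term operation is a projection. -/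
def IsSetAlgebra (Q : UAlgebra σ) : Prop :=
  ∀ (n : ℕ) (t : Term σ n), ∃ i : Fin n, ∀ x : Fin n → Q.carrier, t.eval Q x = x i

/-- An algebra is the full idempotent reduct of a module over some finite ring:
its term operations are exactly the idempotent affine combinations; in
particular the affine operation `x - y + z` is a term operation. -/
def IsAffineAlgebra (Q : UAlgebra σ) : Prop :=
  ∃ (R : Type) (_ : Ring R) (_ : Finite R) (_ : AddCommGroup Q.carrier)
    (_ : Module R Q.carrier),
    (∀ (n : ℕ) (g : (Fin n → Q.carrier) → Q.carrier),
      (∃ t : Term σ n, ∀ x, t.eval Q x = g x) ↔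
      (∃ c : Fin n → R, (∑ i, c i) = 1 ∧ ∀ x, g x = ∑ i, c i • x i)) ∧
    (∃ t : Term σ 3, ∀ x y z : Q.carrier, t.eval Q ![x, y, z] = x - y + z)

/-- `θ` witnesses that `ab` is an edge of the unary type. -/
def UnaryWitness (A : UAlgebra σ) (a b : A.carrier) (θ : Congruence (A.Sg {a, b})) : Prop :=
  θ.IsMaximal ∧ IsSetAlgebra ((A.Sg {a, b}).quot θ)

/-- `θ` witnesses that `ab` is an edge of the semilattice type. -/
def SLWitness (A : UAlgebra σ) (a b : A.carrier) (θ : Congruence (A.Sg {a, b})) : Prop :=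
  θ.IsMaximal ∧ ∃ t : Term σ 2,
    IsSemilatticeOn (fun x y => t.eval ((A.Sg {a, b}).quot θ) ![x, y])
      {A.qa a b θ, A.qb a b θ}

/-- `θ` witnesses that `ab` is an edge of the majority type. -/
def MajWitness (A : UAlgebra σ) (a b : A.carrier) (θ : Congruence (A.Sg {a, b})) : Prop :=
  θ.IsMaximal ∧
  (∃ t : Term σ 3,
    IsMajorityOn (fun x y z => t.eval ((A.Sg {a, b}).quot θ) ![x, y, z])
      {A.qa a b θ, A.qb a b θ}) ∧
  ¬ (∃ t : Term σ 2,
    IsSemilatticeOn (fun x y => t.eval ((A.Sg {a, b}).quot θ) ![x, y])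
      {A.qa a b θ, A.qb a b θ})

/-- `θ` witnesses that `ab` is an edge of the affine type. -/
def AffWitness (A : UAlgebra σ) (a b : A.carrier) (θ : Congruence (A.Sg {a, b})) : Prop :=
  θ.IsMaximal ∧ IsAffineAlgebra ((A.Sg {a, b}).quot θ)

/-- A pair of distinct elements is an edge. -/
def IsEdge (A : UAlgebra σ) (a b : A.carrier) : Prop :=
  a ≠ b ∧ ∃ θ : Congruence (A.Sg {a, b}), ¬ θ.IsFull ∧
    (IsSetAlgebra ((A.Sg {a, b}).quot θ) ∨
     IsAffineAlgebra ((A.Sg {a, b}).quot θ) ∨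
     (∃ t : Term σ 2,
        IsSemilatticeOn (fun x y => t.eval ((A.Sg {a, b}).quot θ) ![x, y])
          {A.qa a b θ, A.qb a b θ}) ∨
     (∃ t : Term σ 3,
        IsMajorityOn (fun x y z => t.eval ((A.Sg {a, b}).quot θ) ![x, y, z])
          {A.qa a b θ, A.qb a b θ}))

def IsUnaryEdge (A : UAlgebra σ) (a b : A.carrier) : Prop :=
  a ≠ b ∧ ∃ θ : Congruence (A.Sg {a, b}), UnaryWitness A a b θ

def IsSLEdge (A : UAlgebra σ) (a b : A.carrier) : Prop :=
  a ≠ b ∧ ∃ θ : Congruence (A.Sg {a, b}), SLWitness A a b θ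

def IsMajEdge (A : UAlgebra σ) (a b : A.carrier) : Prop :=
  a ≠ b ∧ ∃ θ : Congruence (A.Sg {a, b}), MajWitness A a b θ

def IsAffEdge (A : UAlgebra σ) (a b : A.carrier) : Prop :=
  a ≠ b ∧ ∃ θ : Congruence (A.Sg {a, b}), AffWitness A a b θ

end UAlgebra

/-- The four types of edges. -/
inductive EdgeType where
  | unary | semilattice | majority | affine
deriving DecidableEq

namespace UAlgebra

variable {σ : Signature}

def HasEdgeOfType (A : UAlgebra σ) (τ : EdgeType) (a b : A.carrier) : Prop :=
  match τ with
  | .unary => A.IsUnaryEdge a b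
  | .semilattice => A.IsSLEdge a b
  | .majority => A.IsMajEdge a b
  | .affine => A.IsAffEdge a b

/-- `T`-restricted algebra: every edge has a type from `T`. -/
def Restricted (A : UAlgebra σ) (T : Set EdgeType) : Prop :=
  ∀ a b : A.carrier, A.IsEdge a b → ∃ τ ∈ T, A.HasEdgeOfType τ a b

/-- `A` omits type 1: no subalgebra of `A` has an edge of the unary type. -/
def OmitsType1 (A : UAlgebra σ) : Prop :=
  ∀ (S : Set A.carrier) (hS : A.IsClosed S) (a b : (A.subalg S hS).carrier),
    ¬ (A.subalg S hS).IsUnaryEdge a b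

/-- The union of the two `θ`-blocks of a thick edge, as a subset of `A`. -/
def edgeBlockUnion (A : UAlgebra σ) (a b : A.carrier) (θ : Congruence (A.Sg {a, b})) :
    Set A.carrier :=
  {x | ∃ hx : x ∈ A.ClosureSet {a, b},
    θ.rel ⟨x, hx⟩ (A.sgA a b) ∨ θ.rel ⟨x, hx⟩ (A.sgB a b)}

/-- Smooth algebra: for every semilattice- or majority-type edge with a witnessing
maximal congruence, the union of the two blocks is a subuniverse. -/
def IsSmooth (A : UAlgebra σ) : Prop :=
  ∀ (a b : A.carrier) (θ : Congruence (A.Sg {a, b})),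
    (SLWitness A a b θ ∨ MajWitness A a b θ) → A.IsClosed (A.edgeBlockUnion a b θ)

def SemilatticeFree (A : UAlgebra σ) : Prop := ∀ a b : A.carrier, ¬ A.IsSLEdge a b
def MajorityFree (A : UAlgebra σ) : Prop := ∀ a b : A.carrier, ¬ A.IsMajEdge a b
def AffineFree (A : UAlgebra σ) : Prop := ∀ a b : A.carrier, ¬ A.IsAffEdge a b

/-- Thin semilattice edge. -/
def IsThinSLEdge (A : UAlgebra σ) (a b : A.carrier) : Prop :=
  ∃ t : Term σ 2, t.eval A ![a, a] = a ∧ t.eval A ![a, b] = b ∧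
    t.eval A ![b, a] = b ∧ t.eval A ![b, b] = b

/-- Undirected thin majority edge: some term operation is majority on `{a, b}`. -/
def IsUndirThinMajEdge (A : UAlgebra σ) (a b : A.carrier) : Prop :=
  ∃ t : Term σ 3, IsMajorityOn (fun x y z => t.eval A ![x, y, z]) {a, b}

/-- Mal'tsev edge: some term operation is Mal'tsev on `{a, b}`. -/
def IsMaltsevEdge (A : UAlgebra σ) (a b : A.carrier) : Prop :=
  ∃ t : Term σ 3, IsMaltsevOn (fun x y z => t.eval A ![x, y, z]) {a, b}

/-- The class of all quotients of subalgebras of `A`. -/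
def QuotSub (A : UAlgebra σ) : Set (UAlgebra σ) :=
  {B | ∃ (S : Set A.carrier) (hS : A.IsClosed S)
        (θ : Congruence (A.subalg S hS)), B = (A.subalg S hS).quot θ}

end UAlgebra

/-- The class of all quotients of subalgebras of the algebras of a class. -/
def QuotSubClass {σ : Signature} (K : Set (UAlgebra σ)) : Set (UAlgebra σ) :=
  {B | ∃ A ∈ K, B ∈ UAlgebra.QuotSub A}

/-- A ternary term satisfies the majority condition relative to a class `𝒦`. -/
def MajorityCondition {σ : Signature} (𝒦 : Set (UAlgebra σ)) (t : Term σ 3) : Prop :=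
  (∀ B ∈ 𝒦, ∀ x y : B.carrier,
    t.eval B ![x, t.eval B ![x, y, y], t.eval B ![x, y, y]] = t.eval B ![x, y, y]) ∧
  (∀ B ∈ 𝒦, ∀ (a b : B.carrier) (θ : UAlgebra.Congruence (B.Sg {a, b})),
    a ≠ b → UAlgebra.MajWitness B a b θ →
    IsMajorityOn (fun x y z => t.eval ((B.Sg {a, b}).quot θ) ![x, y, z])
      {B.qa a b θ, B.qb a b θ})

/-- A ternary term satisfies the minority condition relative to a class `𝒦`. -/
def MinorityCondition {σ : Signature} (𝒦 : Set (UAlgebra σ)) (t : Term σ 3) : Prop :=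
  (∀ B ∈ 𝒦, ∀ x y : B.carrier,
    t.eval B ![t.eval B ![x, y, y], y, y] = t.eval B ![x, y, y]) ∧
  (∀ B ∈ 𝒦, ∀ (a b : B.carrier) (θ : UAlgebra.Congruence (B.Sg {a, b})),
    a ≠ b → UAlgebra.AffWitness B a b θ →
    IsMaltsevOn (fun x y z => t.eval ((B.Sg {a, b}).quot θ) ![x, y, z])
      {B.qa a b θ, B.qb a b θ})

/-- Thin majority edge relative to a class `𝒦`. -/
def IsThinMajEdge {σ : Signature} (𝒦 : Set (UAlgebra σ)) (A : UAlgebra σ)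
    (a b : A.carrier) : Prop :=
  ∀ t : Term σ 3, MajorityCondition 𝒦 t →
    b ∈ A.ClosureSet {a, t.eval A ![a, b, b]} ∧
    b ∈ A.ClosureSet {a, t.eval A ![b, a, b]} ∧
    b ∈ A.ClosureSet {a, t.eval A ![b, b, a]}

/-- Thin affine edge relative to a class `𝒦` (with respect to some fixed term
operation satisfying the minority condition). -/
def IsThinAffEdge {σ : Signature} (𝒦 : Set (UAlgebra σ)) (A : UAlgebra σ)
    (a b : A.carrier) : Prop :=
  (∃ t : Term σ 3, MinorityCondition 𝒦 t ∧ t.eval A ![b, a, a] = b) ∧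
  ∀ t : Term σ 3, MinorityCondition 𝒦 t → b ∈ A.ClosureSet {a, t.eval A ![a, a, b]}

namespace UAlgebra

variable {σ : Signature}

/-- Reachability in the digraph `Gs(A)` of thin semilattice edges. -/
def sReach (A : UAlgebra σ) : A.carrier → A.carrier → Prop :=
  Relation.ReflTransGen (fun x y => A.IsThinSLEdge x y)

/-- A maximal element of `Gs(A)`: an element of a maximal strongly connected
component. -/
def IsMaxElem (A : UAlgebra σ) (a : A.carrier) : Prop :=
  ∀ b, A.sReach a b → A.sReach b a

/-- A maximal component of `Gs(A)`: the strongly connected component of a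
maximal element. -/
def IsMaxComponent (A : UAlgebra σ) (C : Set A.carrier) : Prop :=
  ∃ a, A.IsMaxElem a ∧ C = {b | A.sReach a b ∧ A.sReach b a}

end UAlgebra

/-- An arc of the digraph `Gas(A)`: a thin semilattice or thin affine edge. -/
def asStep {σ : Signature} (𝒦 : Set (UAlgebra σ)) (A : UAlgebra σ)
    (x y : A.carrier) : Prop :=
  A.IsThinSLEdge x y ∨ IsThinAffEdge 𝒦 A x y

/-- Reachability in `Gas(A)`. -/
def asReach {σ : Signature} (𝒦 : Set (UAlgebra σ)) (A : UAlgebra σ) :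
    A.carrier → A.carrier → Prop :=
  Relation.ReflTransGen (asStep 𝒦 A)

/-- An as-maximal element: an element of an as-component. -/
def IsAsMaxElem {σ : Signature} (𝒦 : Set (UAlgebra σ)) (A : UAlgebra σ)
    (a : A.carrier) : Prop :=
  ∀ b, asReach 𝒦 A a b → asReach 𝒦 A b a

/-- An as-component of `A`: a maximal strongly connected component of `Gas(A)`. -/
def IsAsComponent {σ : Signature} (𝒦 : Set (UAlgebra σ)) (A : UAlgebra σ)
    (C : Set A.carrier) : Prop :=
  ∃ a, IsAsMaxElem 𝒦 A a ∧ C = {b | asReach 𝒦 A a b ∧ asReach 𝒦 A b a}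

namespace UAlgebra

variable {σ : Signature}

/-- Binary direct product. -/
def prod (A B : UAlgebra σ) : UAlgebra σ where
  carrier := A.carrier × B.carrier
  interp f x := (A.interp f fun j => (x j).1, B.interp f fun j => (x j).2)

/-- Direct product of a family. -/
def pi {ι : Type} (A : ι → UAlgebra σ) : UAlgebra σ where
  carrier := ∀ i, (A i).carrier
  interp f x := fun i => (A i).interp f fun j => x j i

/-- Homomorphism of similar algebras. -/
def IsHom (A B : UAlgebra σ) (φ : A.carrier → B.carrier) : Prop :=
  ∀ (f : σ.ops) (x : Fin (σ.arity f) → A.carrier),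
    φ (A.interp f x) = B.interp f fun j => φ (x j)

/-- Simple algebra: only the equality and full congruences. -/
def IsSimple (A : UAlgebra σ) : Prop :=
  ∀ θ : Congruence A, (∀ x y, θ.rel x y ↔ x = y) ∨ θ.IsFull

/-- Maximal generated algebra: generated by one of its maximal components. -/
def MaximalGenerated (A : UAlgebra σ) : Prop :=
  ∃ C : Set A.carrier, A.IsMaxComponent C ∧ A.ClosureSet C = Set.univ

/-- The number of subalgebras (nonempty closed subsets) of an algebra. -/
noncomputable def numSubalgebras (A : UAlgebra σ) : ℕ :=
  Nat.card {S : Set A.carrier // S.Nonempty ∧ A.IsClosed S}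

end UAlgebra

/-- A (k+3)-ary term is an edge term for a class `𝒦`. -/
def IsEdgeTermFor {σ : Signature} (𝒦 : Set (UAlgebra σ)) {k : ℕ}
    (t : Term σ (k + 3)) : Prop :=
  ∀ A ∈ 𝒦, ∀ x y : A.carrier,
    t.eval A (fun i => if i.val ≤ 1 then y else x) = x ∧
    t.eval A (fun i => if i.val = 0 ∨ i.val = 2 then y else x) = x ∧
    ∀ j : Fin (k + 3), 3 ≤ j.val →
      t.eval A (Function.update (fun _ => x) j y) = x

/-- A finite class has few subproducts. -/
def FewSubproducts {σ : Signature} (K : Set (UAlgebra σ)) : Prop :=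
  ∃ p : Polynomial ℕ, ∀ (n : ℕ) (A : Fin n → UAlgebra σ), (∀ i, A i ∈ K) →
    UAlgebra.numSubalgebras (UAlgebra.pi A) ≤ 2 ^ (p.eval n)

/-- `g_K` is bounded by a polynomial: every subalgebra of an `n`-fold product
of members of `K` has a generating set of polynomial size. -/
def PolyGenerated {σ : Signature} (K : Set (UAlgebra σ)) : Prop :=
  ∃ p : Polynomial ℕ, ∀ (n : ℕ) (A : Fin n → UAlgebra σ), (∀ i, A i ∈ K) →
    ∀ S : Set (UAlgebra.pi A).carrier, S.Nonempty → (UAlgebra.pi A).IsClosed S →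
      ∃ G : Set (UAlgebra.pi A).carrier, G ⊆ S ∧ G.Finite ∧
        G.ncard ≤ p.eval n ∧ (UAlgebra.pi A).ClosureSet G = S

namespace Term

variable {σ : Signature}

/-- Substitution of terms for the variables of a term. -/
def subst {m n : ℕ} : Term σ m → (Fin m → Term σ n) → Term σ n
  | .var i, s => s i
  | .app f ts, s => .app f fun j => (ts j).subst s

@[simp]
theorem eval_var {n : ℕ} (A : UAlgebra σ) (i : Fin n) (x : Fin n → A.carrier) :
    (Term.var i : Term σ n).eval A x = x i := rfl

theorem eval_app {n : ℕ} (A : UAlgebra σ) (f : σ.ops) (ts : Fin (σ.arity f) → Term σ n)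
    (x : Fin n → A.carrier) :
    (Term.app f ts).eval A x = A.interp f fun j => (ts j).eval A x := rfl

theorem eval_subst {m n : ℕ} (A : UAlgebra σ) (t : Term σ m) (s : Fin m → Term σ n)
    (x : Fin n → A.carrier) :
    (t.subst s).eval A x = t.eval A fun i => (s i).eval A x := by
  induction t with
  | var i => rfl
  | app f ts ih => simp only [subst, eval_app, ih]

@[simp]
theorem eval_subst₂ {n : ℕ} (A : UAlgebra σ) (t : Term σ 2) (p q : Term σ n)
    (x : Fin n → A.carrier) :
    (t.subst ![p, q]).eval A x = t.eval A ![p.eval A x, q.eval A x] := by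
  rw [eval_subst]
  congr 1
  funext i
  fin_cases i <;> rfl

@[simp]
theorem eval_subst₃ {n : ℕ} (A : UAlgebra σ) (t : Term σ 3) (p q r : Term σ n)
    (x : Fin n → A.carrier) :
    (t.subst ![p, q, r]).eval A x = t.eval A ![p.eval A x, q.eval A x, r.eval A x] := by
  rw [eval_subst]
  congr 1
  funext i
  fin_cases i <;> rfl

theorem eval_const {n : ℕ} {A : UAlgebra σ} (hA : A.Idempotent) (t : Term σ n) (a : A.carrier) :
    t.eval A (fun _ => a) = a := by
  induction t with
  | var i => rfl
  | app f ts ih => simp only [eval_app, ih, hA f a]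

theorem eval_const₂ {A : UAlgebra σ} (hA : A.Idempotent) (t : Term σ 2) (a : A.carrier) :
    t.eval A ![a, a] = a := by
  convert eval_const hA t a using 2
  funext i
  fin_cases i <;> rfl

theorem eval_const₃ {A : UAlgebra σ} (hA : A.Idempotent) (t : Term σ 3) (a : A.carrier) :
    t.eval A ![a, a, a] = a := by
  convert eval_const hA t a using 2
  funext i
  fin_cases i <;> rfl

end Term

namespace UAlgebra

variable {σ : Signature}

theorem IsClosed.eval {A : UAlgebra σ} {S : Set A.carrier} (hS : A.IsClosed S) {n : ℕ}
    (t : Term σ n) {x : Fin n → A.carrier} (hx : ∀ i, x i ∈ S) : t.eval A x ∈ S := by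
  induction t with
  | var i => exact hx i
  | app f ts ih => exact hS f _ ih

theorem IsClosed.eval₃ {A : UAlgebra σ} {S : Set A.carrier} (hS : A.IsClosed S)
    (t : Term σ 3) {x y z : A.carrier} (hx : x ∈ S) (hy : y ∈ S) (hz : z ∈ S) :
    t.eval A ![x, y, z] ∈ S :=
  hS.eval t fun i => by fin_cases i <;> assumption

theorem closureSet_subset {A : UAlgebra σ} {S T : Set A.carrier} (hT : A.IsClosed T)
    (h : S ⊆ T) : A.ClosureSet S ⊆ T := by
  intro x hx
  induction hx with
  | base ha => exact h ha
  | app f x _ ih => exact hT f x ih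

theorem closureSet_pair_subset {A : UAlgebra σ} {T : Set A.carrier} (hT : A.IsClosed T)
    {a b : A.carrier} (ha : a ∈ T) (hb : b ∈ T) : A.ClosureSet {a, b} ⊆ T :=
  closureSet_subset hT (by
    intro x hx
    rcases hx with rfl | rfl
    · exact ha
    · exact hb)

theorem left_mem_closureSet {A : UAlgebra σ} (a b : A.carrier) : a ∈ A.ClosureSet {a, b} :=
  Closure.base (Or.inl rfl)

theorem right_mem_closureSet {A : UAlgebra σ} (a b : A.carrier) : b ∈ A.ClosureSet {a, b} :=
  Closure.base (Or.inr rfl)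

/-- A binary relation between two algebras preserved by all basic operations. -/
def Inv₂ (A B : UAlgebra σ) (R : A.carrier → B.carrier → Prop) : Prop :=
  ∀ (f : σ.ops) (x : Fin (σ.arity f) → A.carrier) (y : Fin (σ.arity f) → B.carrier),
    (∀ j, R (x j) (y j)) → R (A.interp f x) (B.interp f y)

/-- A ternary relation on an algebra preserved by all basic operations. -/
def Inv₃ (A : UAlgebra σ) (M : A.carrier → A.carrier → A.carrier → Prop) : Prop :=
  ∀ (f : σ.ops) (x y z : Fin (σ.arity f) → A.carrier),
    (∀ j, M (x j) (y j) (z j)) → M (A.interp f x) (A.interp f y) (A.interp f z)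

theorem Inv₂.eval {A B : UAlgebra σ} {R : A.carrier → B.carrier → Prop} (hR : Inv₂ A B R)
    {n : ℕ} (t : Term σ n) {x : Fin n → A.carrier} {y : Fin n → B.carrier}
    (h : ∀ i, R (x i) (y i)) : R (t.eval A x) (t.eval B y) := by
  induction t with
  | var i => exact h i
  | app f ts ih => exact hR f _ _ ih

theorem Inv₂.eval₂ {A B : UAlgebra σ} {R : A.carrier → B.carrier → Prop} (hR : Inv₂ A B R)
    (t : Term σ 2) {a b : A.carrier} {a' b' : B.carrier} (ha : R a a') (hb : R b b') :
    R (t.eval A ![a, b]) (t.eval B ![a', b']) :=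
  hR.eval t fun i => by fin_cases i <;> assumption

theorem Inv₂.eval₃ {A B : UAlgebra σ} {R : A.carrier → B.carrier → Prop} (hR : Inv₂ A B R)
    (t : Term σ 3) {a b c : A.carrier} {a' b' c' : B.carrier} (ha : R a a') (hb : R b b')
    (hc : R c c') : R (t.eval A ![a, b, c]) (t.eval B ![a', b', c']) :=
  hR.eval t fun i => by fin_cases i <;> assumption

theorem Inv₃.eval {A : UAlgebra σ} {M : A.carrier → A.carrier → A.carrier → Prop}
    (hM : Inv₃ A M) {n : ℕ} (t : Term σ n) {x y z : Fin n → A.carrier}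
    (h : ∀ i, M (x i) (y i) (z i)) : M (t.eval A x) (t.eval A y) (t.eval A z) := by
  induction t with
  | var i => exact h i
  | app f ts ih => exact hM f _ _ _ ih

theorem Inv₂.swap {A B : UAlgebra σ} {R : A.carrier → B.carrier → Prop} (hR : Inv₂ A B R) :
    Inv₂ B A fun y x => R x y :=
  fun f x y h => hR f y x h

theorem Inv₂.isClosed_right {A : UAlgebra σ} (hA : A.Idempotent) {B : UAlgebra σ}
    {R : A.carrier → B.carrier → Prop} (hR : Inv₂ A B R) (x : A.carrier) :
    B.IsClosed {y | R x y} := fun f y hy => by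
  have := hR f (fun _ => x) y hy
  rwa [hA] at this

theorem Inv₂.isClosed_left {A B : UAlgebra σ} (hB : B.Idempotent)
    {R : A.carrier → B.carrier → Prop} (hR : Inv₂ A B R) (y : B.carrier) :
    A.IsClosed {x | R x y} := hR.swap.isClosed_right hB y

theorem Inv₂.comp {A B C : UAlgebra σ} {R : A.carrier → B.carrier → Prop}
    {R' : B.carrier → C.carrier → Prop} (hR : Inv₂ A B R) (hR' : Inv₂ B C R') :
    Inv₂ A C fun x z => ∃ y, R x y ∧ R' y z := fun f x z h => by
  choose y h₁ h₂ using h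
  exact ⟨B.interp f y, hR f x y h₁, hR' f y z h₂⟩

theorem Inv₂.isClosed_forall {A B : UAlgebra σ} (hB : B.Idempotent)
    {R : A.carrier → B.carrier → Prop} (hR : Inv₂ A B R) :
    A.IsClosed {x | ∀ y, R x y} := fun f x hx y => by
  have := hR f x (fun _ => y) fun j => hx j y
  rwa [hB] at this

theorem Inv₃.section_left {A : UAlgebra σ} (hA : A.Idempotent)
    {M : A.carrier → A.carrier → A.carrier → Prop} (hM : Inv₃ A M) (c : A.carrier) :
    Inv₂ A A (M c) := fun f x y h => by
  have := hM f (fun _ => c) x y h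
  rwa [hA] at this

theorem inv₂_graph {A B : UAlgebra σ} {φ : A.carrier → B.carrier} (h : IsHom A B φ) :
    Inv₂ A B fun x y => φ x = y := fun f x _ hxy =>
  (h f x).trans (congrArg _ (funext hxy))

theorem IsHom.eval {A B : UAlgebra σ} {φ : A.carrier → B.carrier} (h : IsHom A B φ) {n : ℕ}
    (t : Term σ n) (x : Fin n → A.carrier) : φ (t.eval A x) = t.eval B fun i => φ (x i) :=
  (inv₂_graph h).eval t fun _ => rfl

theorem IsHom.eval₂ {A B : UAlgebra σ} {φ : A.carrier → B.carrier} (h : IsHom A B φ)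
    (t : Term σ 2) (x y : A.carrier) : φ (t.eval A ![x, y]) = t.eval B ![φ x, φ y] :=
  (inv₂_graph h).eval₂ t rfl rfl

theorem IsHom.eval₃ {A B : UAlgebra σ} {φ : A.carrier → B.carrier} (h : IsHom A B φ)
    (t : Term σ 3) (x y z : A.carrier) :
    φ (t.eval A ![x, y, z]) = t.eval B ![φ x, φ y, φ z] :=
  (inv₂_graph h).eval₃ t rfl rfl rfl

theorem isHom_val (A : UAlgebra σ) (S : Set A.carrier) (hS : A.IsClosed S) :
    IsHom (A.subalg S hS) A Subtype.val := fun _ _ => rfl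

theorem Idempotent.subalg {A : UAlgebra σ} (hA : A.Idempotent) (S : Set A.carrier)
    (hS : A.IsClosed S) : (A.subalg S hS).Idempotent := fun f a => Subtype.ext (hA f a.1)

theorem isHom_mk {A : UAlgebra σ} (θ : Congruence A) :
    IsHom A (A.quot θ) (Quotient.mk θ.toSetoid) := fun f x => by
  refine Quotient.sound (s := θ.toSetoid) (θ.compat f _ _ fun j => ?_)
  exact θ.symm (Quotient.exact (s := θ.toSetoid) (Quotient.out_eq (Quotient.mk θ.toSetoid (x j))))

theorem IsHom.idempotent {A B : UAlgebra σ} {φ : A.carrier → B.carrier} (h : IsHom A B φ)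
    (hs : Function.Surjective φ) (hA : A.Idempotent) : B.Idempotent := fun f b => by
  obtain ⟨a, rfl⟩ := hs b
  rw [← h f fun _ => a, hA]

theorem Idempotent.quot {A : UAlgebra σ} (hA : A.Idempotent) (θ : Congruence A) :
    (A.quot θ).Idempotent :=
  (isHom_mk θ).idempotent Quotient.mk_surjective hA

theorem IsHom.comp {A B C : UAlgebra σ} {φ : A.carrier → B.carrier} {ψ : B.carrier → C.carrier}
    (hψ : IsHom B C ψ) (hφ : IsHom A B φ) : IsHom A C (ψ ∘ φ) := fun f x => by
  simp only [Function.comp_apply, hφ f x, hψ f]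

/-- The congruence generated by a reflexive compatible relation. -/
def congruenceOfReflexive {A : UAlgebra σ} {R : A.carrier → A.carrier → Prop}
    (hrefl : ∀ x, R x x) (hR : Inv₂ A A R) : Congruence A where
  rel := Relation.EqvGen R
  refl := Relation.EqvGen.refl
  symm h := Relation.EqvGen.symm _ _ h
  trans h h' := Relation.EqvGen.trans _ _ _ h h'
  compat f x y h := by
    classical
    have key : ∀ (s : Finset (Fin (σ.arity f))),
        Relation.EqvGen R (A.interp f x) (A.interp f fun j => if j ∈ s then y j else x j) := by
      intro s
      induction s using Finset.induction_on with
      | empty => simpa using Relation.EqvGen.refl _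
      | insert i s hi ih =>
        refine Relation.EqvGen.trans _ _ _ ih ?_
        have step : ∀ u v, Relation.EqvGen R u v →
            Relation.EqvGen R
              (A.interp f (Function.update (fun j => if j ∈ s then y j else x j) i u))
              (A.interp f (Function.update (fun j => if j ∈ s then y j else x j) i v)) := by
          intro u v huv
          induction huv with
          | rel u v huv =>
            refine Relation.EqvGen.rel _ _ (hR f _ _ fun j => ?_)
            by_cases hj : j = i
            · subst hj; simpa using huv
            · simpa [hj] using hrefl _
          | refl u => exact Relation.EqvGen.refl _
          | symm u v _ ih => exact Relation.EqvGen.symm _ _ ih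
          | trans u v w _ _ ih₁ ih₂ => exact Relation.EqvGen.trans _ _ _ ih₁ ih₂
        have := step _ _ (h i)
        convert this using 3 with j j
        · by_cases hj : j = i
          · subst hj; simp [hi]
          · simp [hj]
        · by_cases hj : j = i
          · subst hj; simp
          · simp [hj]
    simpa using key Finset.univ

theorem eq_of_reflexive_inv₂ {A : UAlgebra σ} (hsimple : A.IsSimple)
    {E : A.carrier → A.carrier → Prop} (hE : Equivalence E) {a b : A.carrier} (hab : ¬ E a b)
    {R : A.carrier → A.carrier → Prop} (hrefl : ∀ x, R x x) (hR : Inv₂ A A R)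
    (hRE : ∀ x y, R x y → E x y) {x y : A.carrier} (hxy : R x y) : x = y := by
  have hle : ∀ u v, Relation.EqvGen R u v → E u v := by
    intro u v huv
    induction huv with
    | rel u v h => exact hRE u v h
    | refl u => exact hE.refl u
    | symm u v _ ih => exact hE.symm ih
    | trans u v w _ _ ih₁ ih₂ => exact hE.trans ih₁ ih₂
  rcases hsimple (congruenceOfReflexive hrefl hR) with h | h
  · exact (h x y).1 (Relation.EqvGen.rel _ _ hxy)
  · exact absurd (hle _ _ (h a b)) hab

end UAlgebra

namespace UAlgebra

variable {σ : Signature}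

/-- Local-to-global principle for Mal'tsev terms of finitely many finite idempotent algebras. -/
theorem exists_maltsev_term {ι : Type} [Finite ι] (B : ι → UAlgebra σ)
    (hid : ∀ i, (B i).Idempotent) (hfin : ∀ i, Finite (B i).carrier)
    (h : ∀ i (a b : (B i).carrier) j (a' b' : (B j).carrier), ∃ s : Term σ 3,
      s.eval (B i) ![a, b, b] = a ∧ s.eval (B j) ![a', a', b'] = b') :
    ∃ p : Term σ 3, ∀ i (x y : (B i).carrier),
      p.eval (B i) ![x, y, y] = x ∧ p.eval (B i) ![x, x, y] = y := by
  classical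
  have := Fintype.ofFinite ι
  have (i : ι) : Fintype (B i).carrier := @Fintype.ofFinite _ (hfin i)
  have left : ∀ j (a' b' : (B j).carrier), ∃ t : Term σ 3,
      (∀ i (a b : (B i).carrier), t.eval (B i) ![a, b, b] = a) ∧
        t.eval (B j) ![a', a', b'] = b' := by
    intro j a' b'
    have key : ∀ s : Finset (Σ i, (B i).carrier × (B i).carrier), ∃ t : Term σ 3,
        (∀ p ∈ s, t.eval (B p.1) ![p.2.1, p.2.2, p.2.2] = p.2.1) ∧
          t.eval (B j) ![a', a', b'] = b' := by
      intro s
      induction s using Finset.induction_on with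
      | empty => exact ⟨.var 2, by simp, rfl⟩
      | insert q s _ ih =>
        obtain ⟨t, ht, ht'⟩ := ih
        obtain ⟨i, a, b⟩ := q
        obtain ⟨s', hs, hs'⟩ := h i a (t.eval (B i) ![a, b, b]) j a' b'
        refine ⟨s'.subst ![.var 0, t.subst ![.var 0, .var 1, .var 1], t], ?_, ?_⟩
        · intro p hp
          rcases Finset.mem_insert.1 hp with rfl | hp
          · simpa using hs
          · simp [ht p hp, Term.eval_const₃ (hid p.1)]
        · simp [ht', Term.eval_const₃ (hid j), hs']
    obtain ⟨t, ht, ht'⟩ := key Finset.univ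
    exact ⟨t, fun i a b => ht ⟨i, a, b⟩ (Finset.mem_univ _), ht'⟩
  have key : ∀ s : Finset (Σ i, (B i).carrier × (B i).carrier), ∃ t : Term σ 3,
      (∀ i (a b : (B i).carrier), t.eval (B i) ![a, b, b] = a) ∧
        ∀ p ∈ s, t.eval (B p.1) ![p.2.1, p.2.1, p.2.2] = p.2.2 := by
    intro s
    induction s using Finset.induction_on with
    | empty => exact ⟨.var 0, fun _ _ _ => rfl, by simp⟩
    | insert q s _ ih =>
      obtain ⟨t, ht, ht'⟩ := ih
      obtain ⟨i, a, b⟩ := q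
      obtain ⟨s', hs, hs'⟩ := left i (t.eval (B i) ![a, a, b]) b
      refine ⟨s'.subst ![t, t.subst ![.var 1, .var 1, .var 2], .var 2], ?_, ?_⟩
      · intro i a b
        simp [ht, hs]
      · intro p hp
        rcases Finset.mem_insert.1 hp with rfl | hp
        · simpa using hs'
        · simp [ht' p hp, Term.eval_const₃ (hid p.1)]
  obtain ⟨t, ht, ht'⟩ := key Finset.univ
  exact ⟨t, fun i x y => ⟨ht i x y, ht' ⟨i, x, y⟩ (Finset.mem_univ _)⟩⟩

end UAlgebra

namespace UAlgebra

variable {σ : Signature}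

section Additive

variable {B : UAlgebra σ} [AddCommGroup B.carrier]

theorem eval_add_of_interp_add
    (hlin : ∀ f (x y : Fin (σ.arity f) → B.carrier),
      B.interp f (fun j => x j + y j) = B.interp f x + B.interp f y)
    {n : ℕ} (t : Term σ n) (x y : Fin n → B.carrier) :
    t.eval B (x + y) = t.eval B x + t.eval B y := by
  induction t with
  | var i => rfl
  | app f ts ih => simp only [Term.eval_app, ih, hlin]

/-- The additive map on powers given by a term of an algebra with additive basic operations. -/
def evalHom (hlin : ∀ f (x y : Fin (σ.arity f) → B.carrier),
      B.interp f (fun j => x j + y j) = B.interp f x + B.interp f y)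
    {n : ℕ} (t : Term σ n) : (Fin n → B.carrier) →+ B.carrier :=
  AddMonoidHom.mk' (t.eval B) (eval_add_of_interp_add hlin t)

theorem eval_eq_sum_single (hlin : ∀ f (x y : Fin (σ.arity f) → B.carrier),
      B.interp f (fun j => x j + y j) = B.interp f x + B.interp f y)
    {n : ℕ} (t : Term σ n) (x : Fin n → B.carrier) :
    t.eval B x = ∑ i, t.eval B (Pi.single i (x i)) := by
  have := map_sum (evalHom hlin t) (fun i => Pi.single i (x i)) Finset.univ
  rw [Finset.univ_sum_single] at this
  exact this

theorem isHom_add_right (hid : B.Idempotent)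
    (hlin : ∀ f (x y : Fin (σ.arity f) → B.carrier),
      B.interp f (fun j => x j + y j) = B.interp f x + B.interp f y) (n : B.carrier) :
    IsHom B B (· + n) := fun f x => by
  rw [hlin f x fun _ => n, hid]

theorem IsClosed.preimage {A B : UAlgebra σ} {φ : A.carrier → B.carrier} (h : IsHom A B φ)
    {U : Set B.carrier} (hU : B.IsClosed U) : A.IsClosed (φ ⁻¹' U) := fun f x hx => by
  rw [Set.mem_preimage, h f x]
  exact hU f _ hx

theorem interp_single_mem {U : Set B.carrier} (hU : B.IsClosed U)
    {v : B.carrier} (h0 : 0 ∈ U) (hv : v ∈ U) (f : σ.ops) (i : Fin (σ.arity f)) :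
    B.interp f (Pi.single i v) ∈ U := by
  refine hU f _ fun j => ?_
  by_cases hj : j = i
  · subst hj; simpa using hv
  · simpa [hj] using h0

/-- A finite simple idempotent algebra with additive basic operations, generated by any two
elements inequivalent for a fixed proper equivalence, is generated by `0` and any nonzero
element. -/
theorem mem_of_isClosed_of_additive (hid : B.Idempotent) (hsimple : B.IsSimple)
    (hlin : ∀ f (x y : Fin (σ.arity f) → B.carrier),
      B.interp f (fun j => x j + y j) = B.interp f x + B.interp f y)
    {E : B.carrier → B.carrier → Prop} (hE : Equivalence E) {a b : B.carrier} (hab : ¬ E a b)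
    (hgen : ∀ c d, ¬ E c d → ∀ U, B.IsClosed U → c ∈ U → d ∈ U → ∀ x, x ∈ U)
    {v : B.carrier} (hv : v ≠ 0) {U : Set B.carrier} (hU : B.IsClosed U) (h0 : 0 ∈ U)
    (hvU : v ∈ U) (x : B.carrier) : x ∈ U := by
  set G : Set B.carrier := {v | ∃ U, B.IsClosed U ∧ 0 ∈ U ∧ v ∈ U ∧ ∃ z, z ∉ U} with hG
  set N := AddSubgroup.closure G with hN
  have hNE : ∀ n ∈ N, ∀ x, E x (x + n) := by
    intro n hn
    induction hn using AddSubgroup.closure_induction with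
    | mem n hn =>
      obtain ⟨U, hU, h0, hn, z, hz⟩ := hn
      intro x
      by_contra hx
      have := hgen _ _ hx _ (hU.preimage (isHom_add_right hid hlin (-x)))
        (by simpa using h0) (by simpa using hn) (z + x)
      exact hz (by simpa using this)
    | zero => intro x; rw [add_zero]; exact hE.refl x
    | add m n _ _ hm hn => intro x; rw [← add_assoc]; exact hE.trans (hm x) (hn _)
    | neg n _ hn => intro x; exact hE.symm (by simpa using hn (x + -n))
  have hsingle : ∀ f i, ∀ n ∈ N, B.interp f (Pi.single i n) ∈ N := by
    intro f i n hn
    have hsub : ∀ x y : B.carrier, B.interp f (Pi.single i (x + y)) =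
        B.interp f (Pi.single i x) + B.interp f (Pi.single i y) := fun x y => by
      rw [Pi.single_add]; exact hlin f _ _
    let φ : B.carrier →+ B.carrier := AddMonoidHom.mk' (fun x => B.interp f (Pi.single i x)) hsub
    induction hn using AddSubgroup.closure_induction with
    | mem n hn =>
      obtain ⟨U, hU, h0, hn, z, hz⟩ := hn
      exact AddSubgroup.subset_closure ⟨U, hU, h0, interp_single_mem hU h0 hn f i, z, hz⟩
    | zero =>
      have : B.interp f (Pi.single i 0) = 0 := map_zero φ
      rw [this]; exact N.zero_mem
    | add m n _ _ hm hn => rw [hsub]; exact N.add_mem hm hn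
    | neg n _ hn =>
      have : B.interp f (Pi.single i (-n)) = - B.interp f (Pi.single i n) := map_neg φ n
      rw [this]; exact N.neg_mem hn
  have hop : ∀ f (x : Fin (σ.arity f) → B.carrier), (∀ j, x j ∈ N) → B.interp f x ∈ N := by
    intro f x hx
    have := eval_eq_sum_single hlin (.app f .var) x
    simp only [Term.eval_app, Term.eval_var] at this
    rw [this]
    exact N.sum_mem fun i _ => hsingle f i _ (hx i)
  let θ : Congruence B :=
    { rel := fun x y => x - y ∈ N
      refl := fun x => by simp
      symm := fun {x y} h => by simpa using N.neg_mem h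
      trans := fun {x y z} h h' => by simpa using N.add_mem h h'
      compat := fun f x y h => by
        have := hlin f (fun j => x j - y j) y
        simp only [sub_add_cancel] at this
        rw [this, add_sub_cancel_right]
        exact hop f _ h }
  rcases hsimple θ with hθ | hθ
  · by_contra hx
    have : v ∈ N := AddSubgroup.subset_closure ⟨U, hU, h0, hvU, x, hx⟩
    exact hv ((hθ v 0).1 (by simpa [θ] using this))
  · have := hNE _ (hθ b a) a
    rw [add_sub_cancel] at this
    exact absurd this hab

theorem exists_term_eq_sub_add [Finite B.carrier] (hid : B.Idempotent) (hsimple : B.IsSimple)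
    (hlin : ∀ f (x y : Fin (σ.arity f) → B.carrier),
      B.interp f (fun j => x j + y j) = B.interp f x + B.interp f y)
    {E : B.carrier → B.carrier → Prop} (hE : Equivalence E) {a b : B.carrier} (hab : ¬ E a b)
    (hgen : ∀ c d, ¬ E c d → ∀ U, B.IsClosed U → c ∈ U → d ∈ U → ∀ x, x ∈ U)
    {d : B.carrier}
    (hd : ∀ R, Inv₂ B B R → R 0 0 → R 0 d → R d 0 → ∀ x y, R x y) :
    ∃ p : Term σ 3, ∀ x y z, p.eval B ![x, y, z] = x - y + z := by
  have gen {v : B.carrier} (hv : v ≠ 0) {U : Set B.carrier} (hU : B.IsClosed U) (h0 : 0 ∈ U)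
      (hvU : v ∈ U) (x : B.carrier) : x ∈ U :=
    mem_of_isClosed_of_additive hid hsimple hlin hE hab hgen hv hU h0 hvU x
  obtain ⟨p, hp⟩ := exists_maltsev_term (ι := Unit) (fun _ => B) (fun _ => hid)
    (fun _ => inferInstance) (by
      intro _ a b _ a' b'
      by_cases hab : a = b
      · exact ⟨.var 2, hab.symm, rfl⟩
      by_cases hab' : a' = b'
      · exact ⟨.var 0, rfl, hab'⟩
      let R : B.carrier → B.carrier → Prop := fun x y => ∃ s : Term σ 3,
        s.eval B ![a, b, b] = x + b ∧ s.eval B ![a', a', b'] = y + a'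
      have hR : Inv₂ B B R := by
        intro f x y h
        choose s h₁ h₂ using h
        refine ⟨.app f s, ?_, ?_⟩
        · simp only [Term.eval_app, h₁]
          exact (isHom_add_right hid hlin b f x).symm
        · simp only [Term.eval_app, h₂]
          exact (isHom_add_right hid hlin a' f y).symm
      have h0 : R 0 0 := ⟨.var 1, by simp, by simp⟩
      have hl : ∀ x, R x 0 := gen (sub_ne_zero.2 hab) (hR.isClosed_left hid 0) h0
        ⟨.var 0, by simp, by simp⟩
      have hr : ∀ y, R 0 y := gen (sub_ne_zero.2 (Ne.symm hab')) (hR.isClosed_right hid 0) h0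
        ⟨.var 2, by simp, by simp⟩
      obtain ⟨s, h₁, h₂⟩ := hd R hR h0 (hr d) (hl d) (a - b) (b' - a')
      exact ⟨s, by simpa using h₁, by simpa using h₂⟩)
  refine ⟨p, fun x y z => ?_⟩
  have h : (![x, y, z] : Fin 3 → B.carrier) = ![x, y, y] + ![0, 0, z - y] := by
    funext i
    fin_cases i <;> simp
  rw [h, eval_add_of_interp_add hlin, (hp () x y).1, (hp () 0 (z - y)).2]
  abel

/-- An algebra with additive basic operations is affine when its binary terms with second
argument `0` are exactly the scalar multiplications of a faithful module. -/
theorem isAffineAlgebra_of_module (hid : B.Idempotent) [Nontrivial B.carrier]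
    (hlin : ∀ f (x y : Fin (σ.arity f) → B.carrier),
      B.interp f (fun j => x j + y j) = B.interp f x + B.interp f y)
    (R : Type) [Ring R] [Finite R] [Module R B.carrier]
    (hfaith : ∀ c c' : R, (∀ x : B.carrier, c • x = c' • x) → c = c')
    (hR : ∀ s : Term σ 2, ∃ c : R, ∀ x, s.eval B ![x, 0] = c • x)
    (hR' : ∀ c : R, ∃ s : Term σ 2, ∀ x, s.eval B ![x, 0] = c • x)
    {p : Term σ 3} (hp : ∀ x y z, p.eval B ![x, y, z] = x - y + z) : B.IsAffineAlgebra := by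
  refine ⟨R, inferInstance, inferInstance, inferInstance, inferInstance, ?_, p, hp⟩
  intro n g
  constructor
  · rintro ⟨t, ht⟩
    have hmem : ∀ i : Fin n, ∃ c : R, ∀ x, t.eval B (Pi.single i x) = c • x := fun i => by
      obtain ⟨c, hc⟩ := hR (t.subst fun j => if j = i then .var 0 else .var 1)
      refine ⟨c, fun x => ?_⟩
      rw [← hc, Term.eval_subst]
      congr 1
      funext j
      by_cases hj : j = i
      · subst hj; simp
      · simp [hj]
    choose c hc using hmem
    have hsum : ∀ x, t.eval B x = ∑ i, c i • x i := fun x => by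
      rw [eval_eq_sum_single hlin t x]
      exact Finset.sum_congr rfl fun i _ => hc i _
    refine ⟨c, hfaith _ _ fun x => ?_, fun x => by rw [← ht, hsum]⟩
    rw [Finset.sum_smul, one_smul, ← hsum fun _ => x, Term.eval_const hid]
  · rintro ⟨c, hc, hg⟩
    cases n with
    | zero =>
      exfalso
      have h : (0 : R) = 1 := by rw [← hc]; exact Finset.sum_empty.symm
      obtain ⟨a, ha⟩ := exists_ne (0 : B.carrier)
      exact ha (by rw [← one_smul R a, ← h, zero_smul])
    | succ m =>
      have key : ∀ S : Finset (Fin (m + 1)), ∃ t : Term σ (m + 1), ∀ x,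
          t.eval B x = x 0 + ∑ i ∈ S, c i • (x i - x 0) := by
        intro S
        induction S using Finset.induction_on with
        | empty => exact ⟨.var 0, fun x => by simp⟩
        | insert i S hi ih =>
          obtain ⟨t, ht⟩ := ih
          obtain ⟨s, hs⟩ := hR' (c i)
          refine ⟨p.subst ![t, .var 0, s.subst ![.var i, .var 0]], fun x => ?_⟩
          have hsplit : (![x i, x 0] : Fin 2 → B.carrier) = ![x i - x 0, 0] + ![x 0, x 0] := by
            funext j
            fin_cases j <;> simp
          have hs' : s.eval B ![x i, x 0] = c i • (x i - x 0) + x 0 := by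
            rw [hsplit, eval_add_of_interp_add hlin, hs, Term.eval_const₂ hid]
          simp only [Term.eval_subst₃, Term.eval_subst₂, Term.eval_var, hp, ht, hs',
            Finset.sum_insert hi]
          abel
      obtain ⟨t, ht⟩ := key Finset.univ
      refine ⟨t, fun x => ?_⟩
      rw [ht, hg]
      simp only [smul_sub, Finset.sum_sub_distrib]
      rw [← Finset.sum_smul, hc, one_smul]
      abel

theorem isAffineAlgebra_of_additive [Finite B.carrier] (hid : B.Idempotent)
    (hsimple : B.IsSimple)
    (hlin : ∀ f (x y : Fin (σ.arity f) → B.carrier),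
      B.interp f (fun j => x j + y j) = B.interp f x + B.interp f y)
    {E : B.carrier → B.carrier → Prop} (hE : Equivalence E) {a b : B.carrier} (hab : ¬ E a b)
    (hgen : ∀ c d, ¬ E c d → ∀ U, B.IsClosed U → c ∈ U → d ∈ U → ∀ x, x ∈ U)
    {d : B.carrier}
    (hd : ∀ R, Inv₂ B B R → R 0 0 → R 0 d → R d 0 → ∀ x y, R x y) :
    B.IsAffineAlgebra := by
  obtain ⟨p, hp⟩ := exists_term_eq_sub_add hid hsimple hlin hE hab hgen hd
  have : Nontrivial B.carrier := ⟨a, b, fun h => hab (h ▸ hE.refl a)⟩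
  let R : Subring (AddMonoid.End B.carrier) :=
    { carrier := {α | ∃ s : Term σ 2, ∀ x, s.eval B ![x, 0] = α x}
      zero_mem' := ⟨.var 1, fun x => rfl⟩
      one_mem' := ⟨.var 0, fun x => rfl⟩
      add_mem' := by
        rintro α β ⟨s, hs⟩ ⟨t, ht⟩
        refine ⟨p.subst ![s, .var 1, t], fun x => ?_⟩
        have : s.eval B ![x, 0] - 0 + t.eval B ![x, 0] = α x + β x := by rw [hs, ht, sub_zero]
        rw [Term.eval_subst₃, hp]
        exact this
      neg_mem' := by
        rintro α ⟨s, hs⟩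
        refine ⟨p.subst ![.var 1, s, .var 1], fun x => ?_⟩
        have : 0 - s.eval B ![x, 0] + 0 = -α x := by rw [hs, zero_sub, add_zero]
        rw [Term.eval_subst₃, hp]
        exact this
      mul_mem' := by
        rintro α β ⟨s, hs⟩ ⟨t, ht⟩
        refine ⟨s.subst ![t, .var 1], fun x => ?_⟩
        have : s.eval B ![t.eval B ![x, 0], 0] = α (β x) := by rw [ht, hs]
        rw [Term.eval_subst₂]
        exact this }
  have hfin : Finite (AddMonoid.End B.carrier) := DFunLike.finite _
  have hfinR : Finite R := Subtype.finite
  refine isAffineAlgebra_of_module hid hlin R ?_ ?_ ?_ hp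
  · intro c c' h
    exact Subtype.ext (AddMonoidHom.ext h)
  · intro s
    have hadd : ∀ x y : B.carrier,
        s.eval B ![x + y, 0] = s.eval B ![x, 0] + s.eval B ![y, 0] := fun x y => by
      rw [← eval_add_of_interp_add hlin]
      congr 1
      funext i
      fin_cases i <;> simp
    exact ⟨⟨AddMonoidHom.mk' (fun x => s.eval B ![x, 0]) hadd, s, fun _ => rfl⟩, fun _ => rfl⟩
  · intro c
    exact c.2

end Additive

end UAlgebra

namespace UAlgebra

variable {σ : Signature} {B : UAlgebra σ}

/-- The binary relation generated by `(c, d)` and `(d, c)`. -/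
def swapRel (B : UAlgebra σ) (c d x y : B.carrier) : Prop :=
  ∃ s : Term σ 2, s.eval B ![c, d] = x ∧ s.eval B ![d, c] = y

/-- The binary relation generated by `(c, c)`, `(c, d)` and `(d, c)`. -/
def cornerRel (B : UAlgebra σ) (c d x y : B.carrier) : Prop :=
  ∃ t : Term σ 3, t.eval B ![c, c, d] = x ∧ t.eval B ![c, d, c] = y

/-- The ternary relation generated by `(c, c, d)`, `(c, d, c)` and `(d, c, c)`. -/
def tripleRel (B : UAlgebra σ) (c d x y z : B.carrier) : Prop :=
  ∃ t : Term σ 3, t.eval B ![c, c, d] = x ∧ t.eval B ![c, d, c] = y ∧ t.eval B ![d, c, c] = z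

theorem swapRel_inv₂ (c d : B.carrier) : Inv₂ B B (B.swapRel c d) := fun f x y h => by
  choose s h₁ h₂ using h
  exact ⟨.app f s, by simp only [Term.eval_app, h₁], by simp only [Term.eval_app, h₂]⟩

theorem cornerRel_inv₂ (c d : B.carrier) : Inv₂ B B (B.cornerRel c d) := fun f x y h => by
  choose s h₁ h₂ using h
  exact ⟨.app f s, by simp only [Term.eval_app, h₁], by simp only [Term.eval_app, h₂]⟩

theorem tripleRel_inv₃ (c d : B.carrier) : Inv₃ B (B.tripleRel c d) := fun f x y z h => by
  choose s h₁ h₂ h₃ using h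
  exact ⟨.app f s, by simp only [Term.eval_app, h₁], by simp only [Term.eval_app, h₂],
    by simp only [Term.eval_app, h₃]⟩

theorem Inv₂.of_swapRel {R : B.carrier → B.carrier → Prop} (hR : Inv₂ B B R) {c d : B.carrier}
    (h₁ : R c d) (h₂ : R d c) {x y : B.carrier} (h : B.swapRel c d x y) : R x y := by
  obtain ⟨s, rfl, rfl⟩ := h
  exact hR.eval₂ s h₁ h₂

theorem Inv₂.of_cornerRel {R : B.carrier → B.carrier → Prop} (hR : Inv₂ B B R)
    {c d : B.carrier} (h₀ : R c c) (h₁ : R c d) (h₂ : R d c) {x y : B.carrier}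
    (h : B.cornerRel c d x y) : R x y := by
  obtain ⟨s, rfl, rfl⟩ := h
  exact hR.eval₃ s h₀ h₁ h₂

theorem swapRel_left (c d : B.carrier) : B.swapRel c d c d := ⟨.var 0, rfl, rfl⟩

theorem swapRel_right (c d : B.carrier) : B.swapRel c d d c := ⟨.var 1, rfl, rfl⟩

theorem swapRel.symm {c d x y : B.carrier} (h : B.swapRel c d x y) : B.swapRel c d y x :=
  (swapRel_inv₂ c d).swap.of_swapRel (swapRel_right c d) (swapRel_left c d) h

theorem swapRel.comm {c d x y : B.carrier} (h : B.swapRel c d x y) : B.swapRel d c x y :=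
  (swapRel_inv₂ d c).of_swapRel (swapRel_right d c) (swapRel_left d c) h

theorem cornerRel_self (c d : B.carrier) : B.cornerRel c d c c := ⟨.var 0, rfl, rfl⟩

theorem cornerRel_left (c d : B.carrier) : B.cornerRel c d c d := ⟨.var 1, rfl, rfl⟩

theorem cornerRel_right (c d : B.carrier) : B.cornerRel c d d c := ⟨.var 2, rfl, rfl⟩

theorem cornerRel.symm {c d x y : B.carrier} (h : B.cornerRel c d x y) : B.cornerRel c d y x :=
  (cornerRel_inv₂ c d).swap.of_cornerRel (cornerRel_self c d) (cornerRel_right c d)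
    (cornerRel_left c d) h

theorem tripleRel.swap_left {c d x y z : B.carrier} (h : B.tripleRel c d x y z) :
    B.tripleRel c d y x z := by
  obtain ⟨t, rfl, rfl, rfl⟩ := h
  exact ⟨t.subst ![.var 0, .var 2, .var 1], by simp, by simp, by simp⟩

theorem tripleRel.swap_right {c d x y z : B.carrier} (h : B.tripleRel c d x y z) :
    B.tripleRel c d x z y := by
  obtain ⟨t, rfl, rfl, rfl⟩ := h
  exact ⟨t.subst ![.var 1, .var 0, .var 2], by simp, by simp, by simp⟩

theorem tripleRel.cornerRel {c d x y z : B.carrier} (h : B.tripleRel c d x y z) :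
    B.cornerRel c d x y := by
  obtain ⟨t, h₁, h₂, -⟩ := h
  exact ⟨t, h₁, h₂⟩

theorem cornerRel.exists_tripleRel {c d x y : B.carrier} (h : B.cornerRel c d x y) :
    ∃ z, B.tripleRel c d x y z := by
  obtain ⟨t, h₁, h₂⟩ := h
  exact ⟨_, t, h₁, h₂, rfl⟩

theorem tripleRel_left (c d : B.carrier) : B.tripleRel c d c c d := ⟨.var 0, rfl, rfl, rfl⟩

/-- A simple finite idempotent algebra with a proper equivalence `E` such that any pair of
inequivalent elements generates the algebra and is neither of semilattice nor of majority type. -/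
structure Untyped (B : UAlgebra σ) (E : B.carrier → B.carrier → Prop) : Prop where
  finite : Finite B.carrier
  idem : B.Idempotent
  simple : B.IsSimple
  equiv : Equivalence E
  exists_not : ∃ a b, ¬ E a b
  gen : ∀ c d, ¬ E c d → ∀ U, B.IsClosed U → c ∈ U → d ∈ U → ∀ x, x ∈ U
  no_semilattice : ∀ c d, ¬ E c d →
    ¬ ∃ s : Term σ 2, s.eval B ![c, d] = c ∧ s.eval B ![d, c] = c
  no_majority : ∀ c d, ¬ E c d → ¬ ∃ t : Term σ 3,
    (t.eval B ![c, c, d] = c ∧ t.eval B ![c, d, c] = c ∧ t.eval B ![d, c, c] = c) ∧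
      t.eval B ![d, d, c] = d ∧ t.eval B ![d, c, d] = d ∧ t.eval B ![c, d, d] = d

namespace Untyped

variable {E : B.carrier → B.carrier → Prop} {c d : B.carrier}

theorem ne (h : Untyped B E) (hcd : ¬ E c d) : c ≠ d :=
  fun e => hcd (e ▸ h.equiv.refl c)

theorem not_symm (h : Untyped B E) (hcd : ¬ E c d) : ¬ E d c :=
  fun e => hcd (h.equiv.symm e)

/-- A compatible relation onto its second coordinate has a full section or is functional. -/
theorem full_or_functional (h : Untyped B E) {R : B.carrier → B.carrier → Prop}
    (hR : Inv₂ B B R) (honto : ∀ y, ∃ x, R x y) :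
    (∃ x, ∀ y, R x y) ∨ ∀ x y y', R x y → R x y' → y = y' := by
  by_cases hρ : ∃ x y y', R x y ∧ R x y' ∧ ¬ E y y'
  · obtain ⟨x, y, y', h₁, h₂, hyy'⟩ := hρ
    exact .inl ⟨x, h.gen _ _ hyy' _ (hR.isClosed_right h.idem x) h₁ h₂⟩
  · push Not at hρ
    obtain ⟨a, b, hab⟩ := h.exists_not
    refine .inr fun x y y' h₁ h₂ => ?_
    exact eq_of_reflexive_inv₂ h.simple h.equiv hab (R := fun y y' => ∃ x, R x y ∧ R x y')
      (fun y => (honto y).imp fun x hx => ⟨hx, hx⟩) (hR.swap.comp hR)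
      (fun y y' ⟨x, h₁, h₂⟩ => hρ x y y' h₁ h₂) ⟨x, h₁, h₂⟩

theorem cornerRel_of_left (h : Untyped B E) (hcd : ¬ E c d) (y : B.carrier) :
    B.cornerRel c d c y :=
  h.gen c d hcd _ ((cornerRel_inv₂ c d).isClosed_right h.idem c) (cornerRel_self c d)
    (cornerRel_left c d) y

theorem swapRel_onto (h : Untyped B E) (hcd : ¬ E c d) (y : B.carrier) :
    ∃ x, B.swapRel c d x y := by
  refine h.gen c d hcd {y | ∃ x, B.swapRel c d x y} (fun f y hy => ?_)
    ⟨d, swapRel_right c d⟩ ⟨c, swapRel_left c d⟩ y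
  choose x hx using hy
  exact ⟨_, swapRel_inv₂ c d f x y hx⟩

/-- An involutive automorphism exchanging `c` and `d`. -/
structure IsSwap (B : UAlgebra σ) (c d : B.carrier) (φ : B.carrier → B.carrier) : Prop where
  hom : IsHom B B φ
  invol : ∀ x, φ (φ x) = x
  left : φ c = d
  right : φ d = c
  swapRel_apply : ∀ x, B.swapRel c d x (φ x)

theorem exists_isSwap (h : Untyped B E) (hcd : ¬ E c d)
    (hfun : ∀ x y y', B.swapRel c d x y → B.swapRel c d x y' → y = y') :
    ∃ φ, IsSwap B c d φ := by
  choose φ hφ using h.swapRel_onto hcd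
  have hφ' : ∀ x, B.swapRel c d x (φ x) := fun x => (hφ x).symm
  refine ⟨φ, fun f x => ?_, fun x => ?_, ?_, ?_, hφ'⟩
  · exact hfun _ _ _ (hφ' _) (swapRel_inv₂ c d f _ _ fun j => hφ' (x j))
  · exact hfun _ _ _ (hφ' _) (hφ x)
  · exact hfun _ _ _ (hφ' _) (swapRel_left c d)
  · exact hfun _ _ _ (hφ' _) (swapRel_right c d)

theorem tripleRel_left_apply (h : Untyped B E) {φ : B.carrier → B.carrier}
    (hφ : IsSwap B c d φ) (y : B.carrier) : B.tripleRel c d c y (φ y) :=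
  ((tripleRel_inv₃ c d).section_left h.idem c).of_swapRel (tripleRel_left c d)
    (tripleRel_left c d).swap_right (hφ.swapRel_apply y)

theorem not_tripleRel_self (h : Untyped B E) (hcd : ¬ E c d) {φ : B.carrier → B.carrier}
    (hφ : IsSwap B c d φ) : ¬ B.tripleRel c d c c c := by
  rintro ⟨t, h₁, h₂, h₃⟩
  refine h.no_majority c d hcd ⟨t, ⟨h₁, h₂, h₃⟩, ?_, ?_, ?_⟩
  · simpa only [hφ.hom.eval₃, hφ.left, hφ.right] using congrArg φ h₁
  · simpa only [hφ.hom.eval₃, hφ.left, hφ.right] using congrArg φ h₂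
  · simpa only [hφ.hom.eval₃, hφ.left, hφ.right] using congrArg φ h₃

theorem tripleRel_left_iff (h : Untyped B E) (hcd : ¬ E c d) {φ : B.carrier → B.carrier}
    (hφ : IsSwap B c d φ)
    (hc : ∀ f, ¬ E f c → E f d → ¬ ∀ x, B.tripleRel c d c f x) {y z : B.carrier} :
    B.tripleRel c d c y z ↔ φ y = z := by
  have hinv := (tripleRel_inv₃ c d).section_left h.idem c
  refine ⟨fun hyz => ?_, fun e => e ▸ h.tripleRel_left_apply hφ y⟩
  rcases h.full_or_functional hinv fun y => ⟨φ y, (h.tripleRel_left_apply hφ y).swap_right⟩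
    with ⟨f, hf⟩ | hfun
  · exfalso
    by_cases hfd : E f d
    · exact hc f (fun e => hcd (h.equiv.trans (h.equiv.symm e) hfd)) hfd hf
    · exact h.not_tripleRel_self hcd hφ (h.gen f d hfd _ (hinv.isClosed_left h.idem c) (hf c)
        (tripleRel_left c d).swap_right c)
  · exact hfun y _ _ (h.tripleRel_left_apply hφ y) hyz

theorem tripleRel_functional (h : Untyped B E) (hcd : ¬ E c d)
    (hE : ∀ x x' y z, ¬ E x x' → (∀ u, B.tripleRel c d u y z) → False)
    {x x' y z : B.carrier} (h₁ : B.tripleRel c d x y z) (h₂ : B.tripleRel c d x' y z) :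
    x = x' := by
  refine eq_of_reflexive_inv₂ h.simple h.equiv hcd
    (R := fun x x' => ∃ y z, B.tripleRel c d x y z ∧ B.tripleRel c d x' y z)
    (fun x => ?_) (fun f x x' hx => ?_) (fun x x' ⟨y, z, h₁, h₂⟩ => ?_) ⟨y, z, h₁, h₂⟩
  · refine h.gen c d hcd {x | ∃ y z, B.tripleRel c d x y z ∧ B.tripleRel c d x y z}
      (fun f x hx => ?_) ⟨c, d, tripleRel_left c d, tripleRel_left c d⟩ ?_ x
    · choose y z h₁ h₂ using hx
      exact ⟨_, _, tripleRel_inv₃ c d f _ _ _ h₁, tripleRel_inv₃ c d f _ _ _ h₂⟩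
    · have := (tripleRel_left c d).swap_right.swap_left
      exact ⟨c, c, this, this⟩
  · choose y z h₁ h₂ using hx
    exact ⟨_, _, tripleRel_inv₃ c d f _ _ _ h₁, tripleRel_inv₃ c d f _ _ _ h₂⟩
  · by_contra hxx'
    refine hE x x' y z hxx' (h.gen x x' hxx' {u | B.tripleRel c d u y z} (fun f x hx => ?_) h₁ h₂)
    have := tripleRel_inv₃ c d f x (fun _ => y) (fun _ => z) hx
    rwa [h.idem, h.idem] at this

end Untyped

end UAlgebra

namespace UAlgebra

namespace Untyped

variable {σ : Signature} {B : UAlgebra σ} {E : B.carrier → B.carrier → Prop} {c d : B.carrier}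

theorem full_of_cornerRel (h : Untyped B E) (hcd : ¬ E c d) {x x' : B.carrier} (hx : ¬ E x c)
    (hx' : ¬ E x' c) (hxx' : B.cornerRel c d x x') (u v : B.carrier) : B.cornerRel c d u v := by
  have hc := h.cornerRel_of_left hcd
  have hfull : ∀ y, B.cornerRel c d x y :=
    h.gen x' c hx' _ ((cornerRel_inv₂ c d).isClosed_right h.idem x) hxx' (hc x).symm
  exact h.gen x c hx _ ((cornerRel_inv₂ c d).isClosed_forall h.idem) hfull hc u v

/-- The configuration in which neither corner relation of `c`, `d` is full. -/
structure CornersNotFull (B : UAlgebra σ) (E : B.carrier → B.carrier → Prop)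
    (c d : B.carrier) (φ : B.carrier → B.carrier) : Prop where
  untyped : Untyped B E
  not_rel : ¬ E c d
  isSwap : IsSwap B c d φ
  rel_of_cornerRel : ∀ x y, B.cornerRel c d x y → ¬ E x c → E y c
  rel_of_cornerRel_swap : ∀ x y, B.cornerRel d c x y → ¬ E x d → E y d

theorem exists_cornersNotFull (h : Untyped B E) (hcd : ¬ E c d)
    (hT : ¬ ∀ x y, B.cornerRel c d x y) (hT' : ¬ ∀ x y, B.cornerRel d c x y) :
    ∃ φ, CornersNotFull B E c d φ := by
  have h₁ : ∀ x y, B.cornerRel c d x y → ¬ E x c → E y c := fun x y hxy hx => by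
    by_contra hy
    exact hT (h.full_of_cornerRel hcd hx hy hxy)
  have h₂ : ∀ x y, B.cornerRel d c x y → ¬ E x d → E y d := fun x y hxy hx => by
    by_contra hy
    exact hT' (h.full_of_cornerRel (h.not_symm hcd) hx hy hxy)
  have hP₁ : ∀ x y, B.swapRel c d x y → B.cornerRel c d x y := fun x y =>
    (cornerRel_inv₂ c d).of_swapRel (cornerRel_left c d) (cornerRel_right c d)
  have hP₂ : ∀ x y, B.swapRel c d x y → B.cornerRel d c x y := fun x y =>
    (cornerRel_inv₂ d c).of_swapRel (cornerRel_right d c) (cornerRel_left d c)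
  rcases h.full_or_functional (swapRel_inv₂ c d) (h.swapRel_onto hcd) with ⟨e, he⟩ | hfun
  · exfalso
    have hec : E e c := by
      by_contra hec
      exact hec (h₁ e e (hP₁ e e (he e)) hec)
    have hed : E e d := by
      by_contra hed
      exact hed (h₂ e e (hP₂ e e (he e)) hed)
    exact hcd (h.equiv.trans (h.equiv.symm hec) hed)
  · obtain ⟨φ, hφ⟩ := h.exists_isSwap hcd hfun
    exact ⟨φ, h, hcd, hφ, h₁, h₂⟩

namespace CornersNotFull

variable {φ : B.carrier → B.carrier}

theorem apply_left (h : CornersNotFull B E c d φ) {x : B.carrier} (hx : E x c) : E (φ x) d := by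
  refine h.rel_of_cornerRel_swap x _ ?_ fun hxd =>
    h.not_rel (h.untyped.equiv.trans (h.untyped.equiv.symm hx) hxd)
  exact (cornerRel_inv₂ d c).of_swapRel (cornerRel_right d c) (cornerRel_left d c)
    (h.isSwap.swapRel_apply x)

theorem apply_right (h : CornersNotFull B E c d φ) {x : B.carrier} (hx : ¬ E x c) :
    E (φ x) c :=
  h.rel_of_cornerRel x _ ((cornerRel_inv₂ c d).of_swapRel (cornerRel_left c d)
    (cornerRel_right c d) (h.isSwap.swapRel_apply x)) hx

theorem rel_right (h : CornersNotFull B E c d φ) {x : B.carrier} (hx : ¬ E x c) : E x d := by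
  have := h.apply_left (h.apply_right hx)
  rwa [h.isSwap.invol] at this

theorem not_rel_left (h : CornersNotFull B E c d φ) {x : B.carrier} (hx : E x d) : ¬ E x c :=
  fun hxc => h.not_rel (h.untyped.equiv.trans (h.untyped.equiv.symm hxc) hx)

theorem tripleRel_iff (h : CornersNotFull B E c d φ) {y z : B.carrier} :
    B.tripleRel c d c y z ↔ φ y = z :=
  h.untyped.tripleRel_left_iff h.not_rel h.isSwap fun f hfc _ hf =>
    h.not_rel (h.untyped.equiv.symm
      (h.rel_of_cornerRel f d (hf d).swap_left.swap_right.cornerRel hfc))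

theorem functional (h : CornersNotFull B E c d φ) {x x' y z : B.carrier}
    (h₁ : B.tripleRel c d x y z) (h₂ : B.tripleRel c d x' y z) : x = x' := by
  refine h.untyped.tripleRel_functional h.not_rel (fun _ _ y z _ hu => ?_) h₁ h₂
  have hz : φ y = z := h.tripleRel_iff.1 (hu c)
  have hdc : ¬ E d c := h.untyped.not_symm h.not_rel
  by_cases hy : E y c
  · exact h.not_rel_left (hz ▸ h.apply_left hy)
      (h.rel_of_cornerRel d z (hu d).swap_right.cornerRel hdc)
  · exact hy (h.rel_of_cornerRel d y (hu d).cornerRel hdc)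

/-- The only element related to everything by the corner relation of `c`, `d` is `c`. -/
theorem eq_of_forall_cornerRel (h : CornersNotFull B E c d φ) {e : B.carrier}
    (he : ∀ x, B.cornerRel c d e x) : e = c := by
  have := h.untyped.finite
  have hcenter := h.untyped.cornerRel_of_left h.not_rel
  refine (eq_of_reflexive_inv₂ h.untyped.simple h.untyped.equiv h.not_rel
    (R := fun x y => ∃ e, (∀ u, B.cornerRel c d e u) ∧ B.tripleRel c d e x (φ y))
    (fun x => ⟨c, hcenter, h.tripleRel_iff.2 rfl⟩) (fun f x y hxy => ?_)
    (fun x y ⟨e, he, hxy⟩ => ?_) ⟨e, he, (h.tripleRel_iff.2 rfl).swap_left⟩).symm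
  · choose e he hxy using hxy
    refine ⟨_, (cornerRel_inv₂ c d).isClosed_forall h.untyped.idem f e he, ?_⟩
    rw [h.isSwap.hom]
    exact tripleRel_inv₃ c d f _ _ _ hxy
  · have hT : ∀ u v, B.tripleRel c d e u v → B.cornerRel c d u v :=
      fun u v huv => huv.swap_left.swap_right.cornerRel
    by_cases hx : E x c
    · suffices hz : ¬ E (φ y) c by
        have := h.apply_right hz
        rw [h.isSwap.invol] at this
        exact h.untyped.equiv.trans hx (h.untyped.equiv.symm this)
      intro hz
      choose g hg using fun u => (he u).exists_tripleRel
      have hgφ : ∀ u, E u c → E (g (φ u)) c := fun u hu =>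
        h.rel_of_cornerRel _ _ (hT _ _ (hg (φ u))) (h.not_rel_left (h.apply_left hu))
      let F : {u // E u c} → {u // E u c} := fun u => ⟨g (φ u.1), hgφ u.1 u.2⟩
      have hF : Function.Injective F := fun u v huv => by
        have huv' : g (φ u.1) = g (φ v.1) := congrArg Subtype.val huv
        have h₁ := hg (φ u.1)
        rw [huv'] at h₁
        have := congrArg φ (h.functional h₁.swap_left (hg (φ v.1)).swap_left)
        rw [h.isSwap.invol, h.isSwap.invol] at this
        exact Subtype.ext this
      obtain ⟨u, hu⟩ := Finite.injective_iff_surjective.1 hF ⟨φ y, hz⟩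
      have hu' : g (φ u.1) = φ y := congrArg Subtype.val hu
      have h₁ := hg (φ u.1)
      rw [hu'] at h₁
      have : φ u.1 = x := h.functional h₁.swap_left hxy.swap_left
      exact h.not_rel_left (h.apply_left u.2) (this ▸ hx)
    · have := h.apply_left (h.rel_of_cornerRel x _ (hT _ _ hxy) hx)
      rw [h.isSwap.invol] at this
      exact h.untyped.equiv.trans (h.rel_right hx) (h.untyped.equiv.symm this)

open Classical in
/-- A term operation depends only on the variables in `J` or only on those outside `J`. -/
theorem eval_eq_or (h : CornersNotFull B E c d φ) {n : ℕ} (t : Term σ n) (J : Set (Fin n)) :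
    (∀ x, t.eval B x = t.eval B (J.piecewise x fun _ => c)) ∨
      ∀ x, t.eval B x = t.eval B (J.piecewise (fun _ => c) x) := by
  have key : ∀ (t : Term σ n) (J : Set (Fin n)),
      ¬ E (t.eval B (J.piecewise (fun _ => d) fun _ => c)) c →
      ∀ x, t.eval B x = t.eval B (J.piecewise x fun _ => c) := by
    intro t J hw x
    have hM : ∀ x, B.tripleRel c d (t.eval B (J.piecewise x fun _ => c))
        (t.eval B (J.piecewise (fun _ => c) x)) (φ (t.eval B x)) := fun x => by
      rw [h.isSwap.hom.eval]
      refine (tripleRel_inv₃ c d).eval t fun i => ?_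
      by_cases hi : i ∈ J
      · simpa [hi] using (h.tripleRel_iff.2 rfl).swap_left
      · simpa [hi] using h.tripleRel_iff.2 rfl
    have hg : t.eval B (J.piecewise (fun _ => c) x) = c := by
      refine h.eq_of_forall_cornerRel ?_
      refine h.untyped.gen _ _ hw _
        ((cornerRel_inv₂ c d).isClosed_right h.untyped.idem _) ?_ ?_
      · have := (hM (J.piecewise (fun _ => d) x)).swap_left.cornerRel
        change B.cornerRel c d _ _
        convert this using 2 <;> funext i <;> by_cases hi : i ∈ J <;> simp [hi]
      · exact (h.untyped.cornerRel_of_left h.not_rel _).symm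
    have := hM x
    rw [hg] at this
    have := congrArg φ (h.tripleRel_iff.1 this.swap_left)
    rw [h.isSwap.invol, h.isSwap.invol] at this
    exact this.symm
  by_cases hw : E (t.eval B (J.piecewise (fun _ => d) fun _ => c)) c
  · right
    have hw' := h.not_rel_left (h.apply_left hw)
    rw [h.isSwap.hom.eval] at hw'
    have hcompl : ∀ x y : Fin n → B.carrier, J.piecewise x y = Jᶜ.piecewise y x := fun x y => by
      rw [Set.piecewise_compl]
    intro x
    rw [hcompl]
    convert key t Jᶜ ?_ x
    convert hw' using 3
    funext i
    by_cases hi : i ∈ J <;> simp [hi, h.isSwap.left, h.isSwap.right]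
  · exact .inl (key t J hw)

theorem isSetAlgebra (h : CornersNotFull B E c d φ) : B.IsSetAlgebra := by
  classical
  intro n t
  by_cases hi : ∃ i : Fin n, ∀ x, t.eval B x = t.eval B (({i} : Set (Fin n)).piecewise x fun _ => c)
  · obtain ⟨i, hi⟩ := hi
    refine ⟨i, fun x => ?_⟩
    rw [hi, ← Term.eval_const h.untyped.idem t (x i), hi fun _ => x i]
    congr 1
    funext j
    by_cases hj : j = i
    · subst hj; simp
    · simp [hj]
  · exfalso
    push Not at hi
    have hdep : ∀ i x, t.eval B x = t.eval B (({i} : Set (Fin n)).piecewise (fun _ => c) x) :=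
      fun i x => by
        have := (h.eval_eq_or t {i}).resolve_left fun hx => (hi i).elim fun x hne => hne (by
          convert hx x)
        convert this x
    have key : ∀ (s : Finset (Fin n)) x, t.eval B x = t.eval B fun j => if j ∈ s then c else x j := by
      intro s
      induction s using Finset.induction_on with
      | empty => intro x; simp
      | insert i s hi ih =>
        intro x
        rw [ih x, hdep i]
        congr 1
        funext j
        by_cases hj : j = i
        · subst hj; simp
        · simp [hj]
    have := key Finset.univ fun _ => d
    simp only [Finset.mem_univ, if_true] at this
    rw [Term.eval_const h.untyped.idem, Term.eval_const h.untyped.idem] at this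
    exact h.untyped.ne h.not_rel this.symm

end CornersNotFull

end Untyped

end UAlgebra

namespace UAlgebra

namespace Untyped

variable {σ : Signature} {B : UAlgebra σ} {E : B.carrier → B.carrier → Prop} {c d : B.carrier}

theorem cornerRel_full_comm {φ : B.carrier → B.carrier}
    (hφ : IsSwap B c d φ) (hT : ∀ x y, B.cornerRel d c x y) (x y : B.carrier) :
    B.cornerRel c d x y := by
  obtain ⟨t, h₁, h₂⟩ := hT (φ x) (φ y)
  refine ⟨t, ?_, ?_⟩
  · rw [← hφ.invol x, ← h₁, hφ.hom.eval₃, hφ.left, hφ.right]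
  · rw [← hφ.invol y, ← h₂, hφ.hom.eval₃, hφ.left, hφ.right]

/-- If for each inequivalent pair one of the corner relations is full, then the swap relations
are graphs of automorphisms. -/
theorem swapRel_functional (h : Untyped B E)
    (hT : ∀ c d, ¬ E c d → (∀ x y, B.cornerRel c d x y) ∨ ∀ x y, B.cornerRel d c x y) :
    ∀ (n : ℕ) (c d : B.carrier), ¬ E c d →
      {p : B.carrier × B.carrier | B.swapRel c d p.1 p.2}.ncard = n →
      ∀ x y y', B.swapRel c d x y → B.swapRel c d x y' → y = y' := by
  have := h.finite
  intro n
  induction n using Nat.strong_induction_on with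
  | _ n ih =>
    have noCenter : ∀ c d, ¬ E c d →
        {p : B.carrier × B.carrier | B.swapRel c d p.1 p.2}.ncard = n →
        ∀ e, ¬ E e d → ¬ ∀ y, B.swapRel c d e y := by
      intro c d hcd hn e hed he
      have hsub : {p : B.carrier × B.carrier | B.swapRel e d p.1 p.2} ⊆
          {p : B.carrier × B.carrier | B.swapRel c d p.1 p.2} := fun p hp =>
        (swapRel_inv₂ c d).of_swapRel (he d) (he d).symm hp
      rcases hsub.eq_or_ssubset with heq | hss
      · have : (e, e) ∈ {p : B.carrier × B.carrier | B.swapRel e d p.1 p.2} := by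
          rw [heq]; exact he e
        exact h.no_semilattice e d hed this
      · obtain ⟨φ, hφ⟩ := h.exists_isSwap hed
          (ih _ (hn ▸ Set.ncard_lt_ncard hss) e d hed rfl)
        have hfull : ∀ x y, B.cornerRel e d x y := (hT e d hed).elim id (cornerRel_full_comm hφ)
        exact h.no_semilattice c d hcd ((swapRel_inv₂ c d).of_cornerRel (he e) (he d)
          (he d).symm (hfull c c))
    intro c d hcd hn
    refine (h.full_or_functional (swapRel_inv₂ c d) (h.swapRel_onto hcd)).resolve_left ?_
    rintro ⟨e, he⟩
    by_cases hed : E e d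
    · refine noCenter d c (h.not_symm hcd) ?_ e
        (fun hec => hcd (h.equiv.trans (h.equiv.symm hec) hed)) fun y => (he y).comm
      rw [← hn]
      congr 1
      ext p
      exact ⟨swapRel.comm, swapRel.comm⟩
    · exact noCenter c d hcd hn e hed he

/-- If a corner relation is full and the triple relation is functional in its first coordinate,
the triple relation is the graph of an abelian group operation and the algebra is affine. -/
theorem isAffineAlgebra_of_full (h : Untyped B E) (hcd : ¬ E c d) {φ : B.carrier → B.carrier}
    (hφ : IsSwap B c d φ) (hfull : ∀ x y, B.cornerRel c d x y)
    (hM : ∀ {y z}, B.tripleRel c d c y z ↔ φ y = z)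
    (hfun : ∀ {x x' y z}, B.tripleRel c d x y z → B.tripleRel c d x' y z → x = x') :
    B.IsAffineAlgebra := by
  have := h.finite
  have hex : ∀ x y, ∃ w, B.tripleRel c d x y (φ w) := fun x y => by
    obtain ⟨z, hz⟩ := (hfull x y).exists_tripleRel
    exact ⟨φ z, by rwa [hφ.invol]⟩
  choose plus hadd using hex
  have huniq : ∀ {x y w}, B.tripleRel c d x y (φ w) → plus x y = w := fun {x y w} hw => by
    have := congrArg φ
      (hfun (hadd x y).swap_right.swap_left hw.swap_right.swap_left)
    rwa [hφ.invol, hφ.invol] at this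
  have hcomm : ∀ x y, plus x y = plus y x := fun x y => huniq (hadd y x).swap_left
  have hzero : ∀ y, plus c y = y := fun y => huniq (hM.2 rfl)
  have hhom : ∀ f (x y : Fin (σ.arity f) → B.carrier),
      B.interp f (fun j => plus (x j) (y j)) = plus (B.interp f x) (B.interp f y) := fun f x y => by
    refine (huniq ?_).symm
    rw [hφ.hom]
    exact tripleRel_inv₃ c d f _ _ _ fun j => hadd (x j) (y j)
  have hassoc : ∀ x y z, plus (plus x y) z = plus x (plus y z) := by
    intro x y z
    have hinv : Inv₂ B B fun y z => plus (plus x y) z = plus x (plus y z) := fun f y z hyz => by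
      have hx : ∀ u, plus x (B.interp f u) = B.interp f fun j => plus x (u j) := fun u => by
        rw [hhom f (fun _ => x), h.idem]
      beta_reduce
      rw [← hhom, hx, ← hhom, hx]
      exact congrArg _ (funext hyz)
    refine hinv.of_cornerRel ?_ ?_ ?_ (hfull y z)
    · rw [hcomm x c, hzero, hzero, hcomm x c, hzero]
    · rw [hcomm x c, hzero, hzero]
    · rw [hcomm (plus x d) c, hzero, hcomm d c, hzero]
  have hneg : ∀ x, ∃ y, plus y x = c := fun x => by
    have hinj : Function.Injective fun y => plus y x := fun y y' hyy' => by
      have h₁ := hadd y x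
      have h₂ := hadd y' x
      simp only at hyy'
      rw [hyy'] at h₁
      exact hfun h₁ h₂
    exact Finite.injective_iff_surjective.1 hinj c
  choose neg hneg using hneg
  let G : AddCommGroup B.carrier :=
    { add := plus
      add_assoc := hassoc
      zero := c
      zero_add := hzero
      add_zero := fun x => (hcomm x c).trans (hzero x)
      neg := neg
      neg_add_cancel := hneg
      add_comm := hcomm
      nsmul := @nsmulRec _ ⟨c⟩ ⟨plus⟩
      zsmul := @zsmulRec _ ⟨c⟩ ⟨plus⟩ ⟨neg⟩ (@nsmulRec _ ⟨c⟩ ⟨plus⟩) }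
  exact isAffineAlgebra_of_additive h.idem h.simple hhom h.equiv hcd h.gen (d := d)
    fun R hR h₀ h₁ h₂ x y => hR.of_cornerRel h₀ h₁ h₂ (hfull x y)

theorem isAffineAlgebra (h : Untyped B E) (hset : ¬ B.IsSetAlgebra) : B.IsAffineAlgebra := by
  have hT : ∀ c d, ¬ E c d → (∀ x y, B.cornerRel c d x y) ∨ ∀ x y, B.cornerRel d c x y := by
    intro c d hcd
    by_contra hT
    rw [not_or] at hT
    obtain ⟨φ, hφ⟩ := h.exists_cornersNotFull hcd hT.1 hT.2
    exact hset hφ.isSetAlgebra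
  have hswap : ∀ c d, ¬ E c d → ∃ φ, IsSwap B c d φ := fun c d hcd =>
    h.exists_isSwap hcd (h.swapRel_functional hT _ c d hcd rfl)
  have hfull : ∀ c d, ¬ E c d → ∀ x y, B.cornerRel c d x y := fun c d hcd => by
    obtain ⟨φ, hφ⟩ := hswap c d hcd
    exact (hT c d hcd).elim id (cornerRel_full_comm hφ)
  obtain ⟨c, d, hcd⟩ := h.exists_not
  obtain ⟨φ, hφ⟩ := hswap c d hcd
  have hcinv := (tripleRel_inv₃ c d).section_left h.idem
  have hM : ∀ {y z}, B.tripleRel c d c y z ↔ φ y = z := fun {y z} => by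
    refine h.tripleRel_left_iff hcd hφ fun f hfc _ hf => h.not_tripleRel_self hcd hφ ?_
    exact (hcinv c).of_cornerRel (hf f) (hf c) (hf c).swap_right (hfull f c hfc c c)
  refine h.isAffineAlgebra_of_full hcd hφ (hfull c d hcd) hM
    (h.tripleRel_functional hcd fun _ _ y z _ hu => ?_)
  obtain ⟨x, hx⟩ : ∃ x, ¬ E z x := by
    by_contra! hz
    exact hcd (h.equiv.trans (h.equiv.symm (hz c)) (hz d))
  have hy : ∀ v, B.tripleRel c d y c v := fun v =>
    (hcinv y).of_cornerRel (hu z).swap_left (hu x).swap_left.swap_right (hu x).swap_left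
      (hfull z x hx c v)
  have h₁ := hM.1 (hy c).swap_left
  have h₂ := hM.1 (hy d).swap_left
  exact h.ne hcd (h₁.symm.trans h₂)

end Untyped

end UAlgebra

theorem exists_pow_succ_isIdempotentElem {M : Type*} [Monoid M] [Finite M] (m : M) :
    ∃ n : ℕ, IsIdempotentElem (m ^ (n + 1)) := by
  obtain ⟨i, j, hij, h⟩ : ∃ i j : ℕ, i < j ∧ m ^ i = m ^ j := by
    obtain ⟨i, j, hne, h⟩ := Finite.exists_ne_map_eq_of_infinite fun n : ℕ => m ^ n
    rcases hne.lt_or_gt with hlt | hlt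
    · exact ⟨i, j, hlt, h⟩
    · exact ⟨j, i, hlt, h.symm⟩
  obtain ⟨p, rfl⟩ := Nat.exists_eq_add_of_lt hij
  have hstep : ∀ n, i ≤ n → ∀ k, m ^ (n + k * (p + 1)) = m ^ n := by
    intro n hn k
    induction k with
    | zero => simp
    | succ k ih =>
      obtain ⟨l, rfl⟩ := Nat.exists_eq_add_of_le hn
      rw [show i + l + (k + 1) * (p + 1) = (i + p + 1) + (l + k * (p + 1)) by ring, pow_add, ← h,
        ← pow_add, ← add_assoc, ih]
  refine ⟨i * (p + 1) + p, ?_⟩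
  rw [IsIdempotentElem, ← pow_add, show i * (p + 1) + p + 1 = (i + 1) * (p + 1) by ring]
  exact hstep _ (by nlinarith) _

namespace UAlgebra

variable {σ : Signature}

theorem finite_subalg {A : UAlgebra σ} (hA : Finite A.carrier) (S : Set A.carrier)
    (hS : A.IsClosed S) : Finite (A.subalg S hS).carrier :=
  inferInstanceAs (Finite {x // x ∈ S})

theorem finite_quot {A : UAlgebra σ} (hA : Finite A.carrier) (θ : Congruence A) :
    Finite (A.quot θ).carrier :=
  inferInstanceAs (Finite (Quotient θ.toSetoid))

theorem Congruence.ext_rel {A : UAlgebra σ} {θ η : Congruence A} (h : θ.rel = η.rel) : θ = η := by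
  cases θ
  cases η
  cases h
  rfl

theorem Congruence.finite {A : UAlgebra σ} (hA : Finite A.carrier) : Finite (Congruence A) :=
  Finite.of_injective (fun θ => θ.rel) fun _ _ => Congruence.ext_rel

theorem isHom_of_mem_quotSub {A B : UAlgebra σ} (hB : B ∈ A.QuotSub) :
    ∃ (S : Set A.carrier) (hS : A.IsClosed S) (φ : (A.subalg S hS).carrier → B.carrier),
      IsHom (A.subalg S hS) B φ ∧ Function.Surjective φ := by
  obtain ⟨S, hS, θ, rfl⟩ := hB
  exact ⟨S, hS, _, isHom_mk θ, Quotient.mk_surjective⟩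

theorem IsAffineAlgebra.exists_local_maltsev {B C : UAlgebra σ} (hBid : B.Idempotent)
    (hB : B.IsAffineAlgebra) (hC : C.IsAffineAlgebra) : ∃ s : Term σ 3,
      (∀ a b, s.eval B ![a, b, b] = a) ∧ ∀ a b, s.eval C ![a, a, b] = b := by
  obtain ⟨R, _, _, _, _, -, p, hp⟩ := hB
  obtain ⟨R', _, _, _, _, hC, q, hq⟩ := hC
  obtain ⟨c, hc, hpc⟩ := (hC 3 (p.eval C)).1 ⟨p, fun _ => rfl⟩
  refine ⟨q.subst ![q.subst ![p, .var 0, p.subst ![.var 0, .var 2, .var 1]], .var 0,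
    p.subst ![.var 2, .var 1, .var 0]], fun a b => ?_, fun a b => ?_⟩
  · simp [hp, Term.eval_const₃ hBid]
  · have hsum : ∀ x : C.carrier, c 0 • x + c 1 • x + c 2 • x = x := fun x => by
      rw [← add_smul, ← add_smul, ← Fin.sum_univ_three, hc, one_smul]
    simp only [Term.eval_subst₃, hq, hpc, Fin.sum_univ_three]
    simp
    have h₁ := hsum a
    have h₂ := hsum b
    calc c 0 • a + c 1 • a + c 2 • b - a + (c 0 • a + c 1 • b + c 2 • a) - a +
          (c 0 • b + c 1 • a + c 2 • a)
        = (c 0 • a + c 1 • a + c 2 • a) + (c 0 • a + c 1 • a + c 2 • a) - a - a +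
          (c 0 • b + c 1 • b + c 2 • b) := by abel
      _ = b := by rw [h₁, h₂]; abel

/-- The `n`-th iterate of a ternary term in its first variable. -/
def iterTerm (h : Term σ 3) : ℕ → Term σ 3
  | 0 => h
  | n + 1 => h.subst ![(iterTerm h n).subst ![.var 0, .var 1, .var 1], .var 1, .var 2]

theorem eval_iterTerm (A : UAlgebra σ) (h : Term σ 3) (n : ℕ) (x y : A.carrier) :
    (iterTerm h n).eval A ![x, y, y] = (fun u => h.eval A ![u, y, y])^[n + 1] x := by
  induction n with
  | zero => rfl
  | succ n ih =>
    rw [Function.iterate_succ_apply', ← ih]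
    simp [iterTerm]

theorem iterTerm_maltsev {A : UAlgebra σ} {h : Term σ 3}
    (hh : ∀ x y, h.eval A ![x, y, y] = x ∧ h.eval A ![x, x, y] = y) (n : ℕ) (x y : A.carrier) :
    (iterTerm h n).eval A ![x, y, y] = x ∧ (iterTerm h n).eval A ![x, x, y] = y := by
  induction n generalizing x y with
  | zero => exact hh x y
  | succ n ih => simp [iterTerm, ih, hh]

theorem exists_iterTerm_idempotent {A : UAlgebra σ} (hA : Finite A.carrier) (h : Term σ 3) :
    ∃ n, ∀ x y : A.carrier, (iterTerm h n).eval A ![(iterTerm h n).eval A ![x, y, y], y, y] =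
      (iterTerm h n).eval A ![x, y, y] := by
  have : Finite (Function.End A.carrier) := inferInstanceAs (Finite (A.carrier → A.carrier))
  let r : A.carrier → Function.End A.carrier := fun y u => h.eval A ![u, y, y]
  obtain ⟨n, hn⟩ := exists_pow_succ_isIdempotentElem r
  refine ⟨n, fun x y => ?_⟩
  have hr : ∀ u, (iterTerm h n).eval A ![u, y, y] = (r ^ (n + 1)) y u := fun u => by
    rw [eval_iterTerm, Pi.pow_apply]
    exact (congrFun (hom_coe_pow (fun g : Function.End A.carrier => g) rfl (fun _ _ => rfl)
      (r y) (n + 1)) u).symm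
  rw [hr, hr]
  exact congrFun (congrFun hn y) x

theorem eval_idempotent_of_mem_quotSub {A B : UAlgebra σ} (hB : B ∈ A.QuotSub) {t : Term σ 3}
    (ht : ∀ x y : A.carrier, t.eval A ![t.eval A ![x, y, y], y, y] = t.eval A ![x, y, y])
    (x y : B.carrier) : t.eval B ![t.eval B ![x, y, y], y, y] = t.eval B ![x, y, y] := by
  obtain ⟨S, hS, φ, hφ, hsurj⟩ := isHom_of_mem_quotSub hB
  obtain ⟨x, rfl⟩ := hsurj x
  obtain ⟨y, rfl⟩ := hsurj y
  rw [← hφ.eval₃, ← hφ.eval₃]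
  congr 1
  refine Subtype.ext ?_
  have hval := isHom_val A S hS
  have := ht x.1 y.1
  rw [← hval.eval₃, ← hval.eval₃] at this
  exact this

theorem exists_minorityCondition {A : UAlgebra σ} (hA : Finite A.carrier) (hid : A.Idempotent) :
    ∃ t : Term σ 3, MinorityCondition A.QuotSub t := by
  have hfin₁ := finite_subalg hA
  have hfin₂ := fun S hS => Congruence.finite (hfin₁ S hS)
  have hfin₃ := fun S hS θ => finite_quot (hfin₁ S hS) θ
  let Q : ∀ (S : {S : Set A.carrier // A.IsClosed S}), Congruence (A.subalg S.1 S.2) → UAlgebra σ :=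
    fun S θ => (A.subalg S.1 S.2).quot θ
  have hQ : ∀ S θ, Finite (Q S θ).carrier := fun S θ => hfin₃ S.1 S.2 θ
  have hη : ∀ S θ a b, Finite (Congruence ((Q S θ).Sg {a, b})) := fun S θ a b =>
    Congruence.finite (finite_subalg (hQ S θ) _ _)
  let ι := Σ (S : {S : Set A.carrier // A.IsClosed S}) (θ : Congruence (A.subalg S.1 S.2))
    (a b : (Q S θ).carrier), {η : Congruence ((Q S θ).Sg {a, b}) // AffWitness _ a b η}
  let B : ι → UAlgebra σ := fun i => ((Q i.1 i.2.1).Sg {i.2.2.1, i.2.2.2.1}).quot i.2.2.2.2.1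
  have hι : Finite ι := by
    have (S : {S : Set A.carrier // A.IsClosed S}) : Finite (Congruence (A.subalg S.1 S.2)) :=
      hfin₂ S.1 S.2
    infer_instance
  have hBid : ∀ i, (B i).Idempotent := fun i =>
    (((hid.subalg _ _).quot _).subalg _ _).quot _
  have hBfin : ∀ i, Finite (B i).carrier := fun i =>
    finite_quot (finite_subalg (hQ i.1 i.2.1) _ _) _
  have haff : ∀ i, (B i).IsAffineAlgebra := fun i => i.2.2.2.2.2.2
  obtain ⟨h, hh⟩ := exists_maltsev_term B hBid hBfin fun i a b j a' b' => by
    obtain ⟨s, hs, hs'⟩ := IsAffineAlgebra.exists_local_maltsev (hBid i) (haff i) (haff j)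
    exact ⟨s, hs a b, hs' a' b'⟩
  obtain ⟨n, hn⟩ := exists_iterTerm_idempotent hA h
  refine ⟨iterTerm h n, fun B hB => eval_idempotent_of_mem_quotSub hB hn, ?_⟩
  rintro _ ⟨S, hS, θ, rfl⟩ a b η _ hη
  intro x _ y _
  have hxy := fun x y => iterTerm_maltsev (hh ⟨⟨S, hS⟩, θ, a, b, η, hη⟩) n x y
  exact ⟨(hxy x y).1, (hxy y x).2⟩

end UAlgebra

theorem isSemilatticeOn_image {α β : Type} {e : α → β} (he : Function.Injective e)
    {f : α → α → α} {g : β → β → β} (h : ∀ x y, e (f x y) = g (e x) (e y)) (B : Set α) :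
    IsSemilatticeOn g (e '' B) ↔ IsSemilatticeOn f B := by
  simp only [IsSemilatticeOn, Set.forall_mem_image, ← h, he.eq_iff]

theorem isMajorityOn_image {α β : Type} {e : α → β} (he : Function.Injective e)
    {f : α → α → α → α} {g : β → β → β → β} (h : ∀ x y z, e (f x y z) = g (e x) (e y) (e z))
    (B : Set α) : IsMajorityOn g (e '' B) ↔ IsMajorityOn f B := by
  simp only [IsMajorityOn, Set.forall_mem_image, ← h, he.eq_iff]

theorem isMaltsevOn_image {α β : Type} {e : α → β} (he : Function.Injective e)
    {f : α → α → α → α} {g : β → β → β → β} (h : ∀ x y z, e (f x y z) = g (e x) (e y) (e z))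
    (B : Set α) : IsMaltsevOn g (e '' B) ↔ IsMaltsevOn f B := by
  simp only [IsMaltsevOn, Set.forall_mem_image, ← h, he.eq_iff]

namespace UAlgebra

variable {σ : Signature} {A B Q : UAlgebra σ}

theorem IsHom.isClosed_range {φ : A.carrier → B.carrier} (h : IsHom A B φ) :
    B.IsClosed (Set.range φ) := fun f x hx => by
  choose y hy using hx
  exact ⟨A.interp f y, by simp [h f y, hy]⟩

/-- The preimage of a congruence under a homomorphism. -/
def Congruence.comap {φ : A.carrier → B.carrier} (h : IsHom A B φ) (θ : Congruence B) :
    Congruence A where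
  rel x y := θ.rel (φ x) (φ y)
  refl x := θ.refl _
  symm := θ.symm
  trans := θ.trans
  compat f x y hxy := by
    rw [h, h]
    exact θ.compat f _ _ hxy

/-- The equality congruence. -/
def Congruence.eq (A : UAlgebra σ) : Congruence A where
  rel x y := x = y
  refl _ := rfl
  symm := Eq.symm
  trans := Eq.trans
  compat f x y h := by rw [funext h]

/-- The kernel of a homomorphism. -/
def IsHom.ker {φ : A.carrier → B.carrier} (h : IsHom A B φ) : Congruence A :=
  (Congruence.eq B).comap h

/-- The image of a congruence above the kernel of a surjective homomorphism. -/
def Congruence.map {φ : A.carrier → B.carrier} (h : IsHom A B φ) (hsurj : Function.Surjective φ)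
    (θ : Congruence A) (hθ : h.ker.le θ) : Congruence B where
  rel u v := ∃ x y, φ x = u ∧ φ y = v ∧ θ.rel x y
  refl u := by
    obtain ⟨x, rfl⟩ := hsurj u
    exact ⟨x, x, rfl, rfl, θ.refl x⟩
  symm := by
    rintro u v ⟨x, y, hx, hy, hxy⟩
    exact ⟨y, x, hy, hx, θ.symm hxy⟩
  trans := by
    rintro u v w ⟨x, y, hx, hy, hxy⟩ ⟨y', z, hy', hz, hyz⟩
    exact ⟨x, z, hx, hz, θ.trans hxy (θ.trans (hθ _ _ (hy.trans hy'.symm)) hyz)⟩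
  compat f u v huv := by
    choose x y hx hy hxy using huv
    exact ⟨A.interp f x, A.interp f y, by simp [h f, hx], by simp [h f, hy], θ.compat f x y hxy⟩

theorem IsHom.ker_isMaximal {φ : A.carrier → B.carrier} (h : IsHom A B φ)
    (hsurj : Function.Surjective φ) (hsimple : B.IsSimple) {x y : A.carrier} (hxy : φ x ≠ φ y) :
    h.ker.IsMaximal := by
  refine ⟨fun hfull => hxy (hfull x y), fun η hη hfull => ?_⟩
  rcases hsimple (η.map h hsurj hη) with heq | hall
  · exact fun u v huv => (heq _ _).1 ⟨u, v, rfl, rfl, huv⟩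
  · refine absurd (fun u v => ?_) hfull
    obtain ⟨u', v', hu, hv, huv⟩ := hall (φ u) (φ v)
    exact η.trans (hη _ _ hu.symm) (η.trans huv (hη _ _ hv))

theorem IsHom.exists_equiv_quot_ker {φ : A.carrier → B.carrier} (h : IsHom A B φ)
    (hsurj : Function.Surjective φ) : ∃ e : (A.quot h.ker).carrier ≃ B.carrier,
      IsHom (A.quot h.ker) B e ∧ ∀ x, e (Quotient.mk h.ker.toSetoid x) = φ x := by
  let e : (A.quot h.ker).carrier → B.carrier := Quotient.lift φ fun _ _ hxy => hxy
  have he : Function.Bijective e := by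
    refine ⟨fun u v => Quotient.inductionOn₂ u v fun x y hxy => Quotient.sound hxy, fun u => ?_⟩
    obtain ⟨x, rfl⟩ := hsurj u
    exact ⟨Quotient.mk _ x, rfl⟩
  refine ⟨Equiv.ofBijective e he, fun f u => ?_, fun _ => rfl⟩
  have hu : u = fun j => Quotient.mk h.ker.toSetoid (Quotient.out (s := h.ker.toSetoid) (u j)) :=
    funext fun j => (Quotient.out_eq (s := h.ker.toSetoid) (u j)).symm
  rw [hu, ← isHom_mk h.ker]
  exact h f _

theorem Congruence.IsMaximal.isSimple_quot {θ : Congruence A} (hθ : θ.IsMaximal) :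
    (A.quot θ).IsSimple := fun η => by
  by_cases hfull : (η.comap (isHom_mk θ)).IsFull
  · refine .inr fun u v => Quotient.inductionOn₂ u v fun x y => hfull x y
  · refine .inl fun u v => ⟨?_, fun huv => huv ▸ η.refl u⟩
    refine Quotient.inductionOn₂ u v fun x y hxy => Quotient.sound ?_
    refine hθ.2 _ (fun x y hxy => ?_) hfull x y hxy
    change η.rel (Quotient.mk _ x) (Quotient.mk _ y)
    rw [Quotient.sound hxy]
    exact η.refl _

theorem exists_isMaximal (hA : Finite A.carrier) {a b : A.carrier} (hab : a ≠ b) :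
    ∃ θ : Congruence A, θ.IsMaximal := by
  have := Congruence.finite hA
  have : Nonempty {θ : Congruence A // ¬ θ.IsFull} :=
    ⟨Congruence.eq A, fun hfull => hab (hfull a b)⟩
  obtain ⟨θ, hθ⟩ := Finite.exists_max fun θ : {θ : Congruence A // ¬ θ.IsFull} =>
    {p : A.carrier × A.carrier | θ.1.rel p.1 p.2}.ncard
  refine ⟨θ, θ.2, fun η hle hη x y hxy => ?_⟩
  have hsub : {p : A.carrier × A.carrier | θ.1.rel p.1 p.2} ⊆ {p | η.rel p.1 p.2} :=
    fun p hp => hle p.1 p.2 hp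
  have heq := Set.eq_of_subset_of_ncard_le hsub (hθ ⟨η, hη⟩) (Set.toFinite _)
  exact (Set.ext_iff.1 heq (x, y)).2 hxy

theorem IsSetAlgebra.of_injective {φ : A.carrier → B.carrier} (h : IsHom A B φ)
    (hinj : Function.Injective φ) (hB : B.IsSetAlgebra) : A.IsSetAlgebra := fun n t => by
  obtain ⟨i, hi⟩ := hB n t
  exact ⟨i, fun x => hinj (by rw [h.eval, hi])⟩

theorem IsAffineAlgebra.of_equiv {e : A.carrier ≃ B.carrier} (h : IsHom A B e)
    (hB : B.IsAffineAlgebra) : A.IsAffineAlgebra := by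
  obtain ⟨R, hring, hR, _, _, hterm, t, ht⟩ := hB
  let hgrp : AddCommGroup A.carrier := e.addCommGroup
  let hmod : Module R A.carrier := e.module R
  let l : A.carrier ≃ₗ[R] B.carrier := e.linearEquiv R
  have hl : ∀ x, l x = e x := fun _ => rfl
  have hsum : ∀ {n : ℕ} (c : Fin n → R) (x : Fin n → A.carrier),
      e (∑ i, c i • x i) = ∑ i, c i • e (x i) := fun c x => by
    rw [← hl, map_sum]
    exact Finset.sum_congr rfl fun i _ => l.map_smul (c i) (x i)
  refine ⟨R, hring, hR, hgrp, hmod, fun n g => ?_, t, fun x y z => ?_⟩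
  · have h₁ : (∃ t : Term σ n, ∀ x, t.eval A x = g x) ↔
        ∃ t : Term σ n, ∀ x, t.eval B x = e (g (fun i => e.symm (x i))) := by
      refine exists_congr fun t => ⟨fun ht x => ?_, fun ht x => e.injective ?_⟩
      · rw [← ht, h.eval]
        simp
      · rw [h.eval, ht]
        simp
    rw [h₁, hterm n fun x => e (g (fun i => e.symm (x i)))]
    refine exists_congr fun c => and_congr_right fun _ => ⟨fun hg x => ?_, fun hg x => ?_⟩
    · refine e.injective ?_
      rw [hsum, ← hg]
      simp
    · rw [hg, hsum]
      simp
  · apply l.injective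
    rw [map_add, map_sub, hl, h.eval₃, ht]
    rfl

section

variable {x y : A.carrier} {φ : (A.Sg {x, y}).carrier → Q.carrier}

theorem exists_equiv_isMaximal (hφ : IsHom (A.Sg {x, y}) Q φ) (hsurj : Function.Surjective φ)
    (hsimple : Q.IsSimple) (hne : φ (A.sgA x y) ≠ φ (A.sgB x y)) :
    ∃ (θ : Congruence (A.Sg {x, y})) (e : ((A.Sg {x, y}).quot θ).carrier ≃ Q.carrier),
      x ≠ y ∧ θ.IsMaximal ∧ IsHom ((A.Sg {x, y}).quot θ) Q e ∧
      e '' {A.qa x y θ, A.qb x y θ} = {φ (A.sgA x y), φ (A.sgB x y)} := by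
  obtain ⟨e, he, heq⟩ := hφ.exists_equiv_quot_ker hsurj
  refine ⟨hφ.ker, e, fun hxy => hne ?_, hφ.ker_isMaximal hsurj hsimple hne, he, ?_⟩
  · exact congrArg φ (Subtype.ext hxy)
  · rw [Set.image_pair, qa, qb, heq, heq]

theorem IsSetAlgebra.isUnaryEdge (hset : Q.IsSetAlgebra) (hφ : IsHom (A.Sg {x, y}) Q φ)
    (hsurj : Function.Surjective φ) (hsimple : Q.IsSimple)
    (hne : φ (A.sgA x y) ≠ φ (A.sgB x y)) : A.IsUnaryEdge x y := by
  obtain ⟨θ, e, hxy, hθ, he, -⟩ := exists_equiv_isMaximal hφ hsurj hsimple hne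
  exact ⟨hxy, θ, hθ, hset.of_injective he e.injective⟩

theorem SemilatticeFree.not_isSemilatticeOn (hsf : A.SemilatticeFree)
    (hφ : IsHom (A.Sg {x, y}) Q φ) (hsurj : Function.Surjective φ) (hsimple : Q.IsSimple)
    (hne : φ (A.sgA x y) ≠ φ (A.sgB x y)) :
    ¬ ∃ s : Term σ 2, IsSemilatticeOn (fun u v => s.eval Q ![u, v])
      {φ (A.sgA x y), φ (A.sgB x y)} := by
  rintro ⟨s, hs⟩
  obtain ⟨θ, e, hxy, hθ, he, hpair⟩ := exists_equiv_isMaximal hφ hsurj hsimple hne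
  rw [← hpair] at hs
  exact hsf x y ⟨hxy, θ, hθ, s, (isSemilatticeOn_image e.injective
    (fun u v => he.eval₂ s u v) _).1 hs⟩

end

section

variable {𝒦 : Set (UAlgebra σ)} {c d : Q.carrier}

theorem exists_equiv_sg (hsimple : Q.IsSimple) (hgen : Q.ClosureSet {c, d} = Set.univ)
    (hne : c ≠ d) : ∃ (θ : Congruence (Q.Sg {c, d}))
      (e : ((Q.Sg {c, d}).quot θ).carrier ≃ Q.carrier), θ.IsMaximal ∧
      IsHom ((Q.Sg {c, d}).quot θ) Q e ∧ e '' {Q.qa c d θ, Q.qb c d θ} = {c, d} := by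
  obtain ⟨θ, e, -, hθ, he, hpair⟩ := exists_equiv_isMaximal
    (isHom_val Q _ (Q.closureSet_isClosed {c, d}))
    (fun u => ⟨⟨u, hgen ▸ Set.mem_univ u⟩, rfl⟩) hsimple hne
  exact ⟨θ, e, hθ, he, hpair⟩

theorem _root_.MajorityCondition.isMajorityOn {t : Term σ 3} (ht : MajorityCondition 𝒦 t)
    (hQ : Q ∈ 𝒦) (hsimple : Q.IsSimple) (hgen : Q.ClosureSet {c, d} = Set.univ) (hne : c ≠ d)
    (hmaj : ∃ s : Term σ 3, IsMajorityOn (fun u v w => s.eval Q ![u, v, w]) {c, d})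
    (hsl : ¬ ∃ s : Term σ 2, IsSemilatticeOn (fun u v => s.eval Q ![u, v]) {c, d}) :
    IsMajorityOn (fun u v w => t.eval Q ![u, v, w]) {c, d} := by
  obtain ⟨θ, e, hθ, he, hpair⟩ := exists_equiv_sg hsimple hgen hne
  rw [← hpair] at hmaj hsl ⊢
  have hiff := fun s : Term σ 3 => isMajorityOn_image e.injective
    (g := fun u v w => s.eval Q ![u, v, w]) (fun u v w => he.eval₃ s u v w) {Q.qa c d θ, Q.qb c d θ}
  have hiff' := fun s : Term σ 2 => isSemilatticeOn_image e.injective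
    (g := fun u v => s.eval Q ![u, v]) (fun u v => he.eval₂ s u v) {Q.qa c d θ, Q.qb c d θ}
  simp only [hiff, hiff'] at hmaj hsl ⊢
  exact ht.2 Q hQ c d θ hne ⟨hθ, hmaj, hsl⟩

theorem _root_.MinorityCondition.isMaltsevOn {t : Term σ 3} (ht : MinorityCondition 𝒦 t)
    (hQ : Q ∈ 𝒦) (hsimple : Q.IsSimple) (hgen : Q.ClosureSet {c, d} = Set.univ) (hne : c ≠ d)
    (haff : Q.IsAffineAlgebra) : IsMaltsevOn (fun u v w => t.eval Q ![u, v, w]) {c, d} := by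
  obtain ⟨θ, e, hθ, he, hpair⟩ := exists_equiv_sg hsimple hgen hne
  rw [← hpair, isMaltsevOn_image e.injective (fun u v w => he.eval₃ t u v w)]
  exact ht.2 Q hQ c d θ hne ⟨hθ, haff.of_equiv he⟩

end

end UAlgebra

namespace UAlgebra

variable {σ : Signature} {A Q : UAlgebra σ}

/-- Connectivity by directed paths of thin affine and thin majority edges. -/
def ThinReach (A : UAlgebra σ) : A.carrier → A.carrier → Prop :=
  Relation.ReflTransGen fun x y => IsThinAffEdge A.QuotSub A x y ∨ IsThinMajEdge A.QuotSub A x y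

theorem exists_closureSet_minimal (hA : Finite A.carrier) (x : A.carrier) {D : Set A.carrier}
    (hD : D.Nonempty) : ∃ y ∈ D, ∀ z ∈ D, z ∈ A.ClosureSet {x, y} →
      ∀ w ∈ D, w ∈ A.ClosureSet {x, z} → z ∈ A.ClosureSet {x, w} := by
  have : Nonempty D := hD.to_subtype
  obtain ⟨⟨y, hy⟩, hmin⟩ := Finite.exists_min fun y : D => (A.ClosureSet {x, y.1}).ncard
  have hmono : ∀ {u v : A.carrier}, u ∈ A.ClosureSet {x, v} →
      A.ClosureSet {x, u} ⊆ A.ClosureSet {x, v} := fun hu =>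
    closureSet_pair_subset (A.closureSet_isClosed _) (left_mem_closureSet _ _) hu
  refine ⟨y, hy, fun z _ hzy w hw hwz => ?_⟩
  have hsub := (hmono hwz).trans (hmono hzy)
  have heq := Set.eq_of_subset_of_ncard_le hsub (hmin ⟨w, hw⟩) (Set.toFinite _)
  rw [heq]
  exact hzy

section

variable {S : Set A.carrier} {hS : A.IsClosed S} {φ : (A.subalg S hS).carrier → Q.carrier}

theorem exists_isThinMajEdge (hA : Finite A.carrier)
    (hφ : IsHom (A.subalg S hS) Q φ) (x y : (A.subalg S hS).carrier)
    (hmaj : ∀ t, MajorityCondition A.QuotSub t →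
      IsMajorityOn (fun u v w => t.eval Q ![u, v, w]) {φ x, φ y}) :
    ∃ z, φ z = φ y ∧ IsThinMajEdge A.QuotSub A x.1 z.1 := by
  obtain ⟨_, ⟨z, hz, rfl⟩, hmin⟩ := exists_closureSet_minimal hA x.1
    (D := Subtype.val '' {z | φ z = φ y}) ⟨y.1, y, rfl, rfl⟩
  have hzmem := right_mem_closureSet x.1 z.1
  have hstep : ∀ t : Term σ 3, ∀ p q r : (A.subalg S hS).carrier,
      (p = x ∨ p = z) → (q = x ∨ q = z) → (r = x ∨ r = z) →
      t.eval Q ![φ p, φ q, φ r] = φ y → z.1 ∈ A.ClosureSet {x.1, t.eval A ![p.1, q.1, r.1]} := by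
    intro t p q r hp hq hr h
    have hmem : ∀ {p : (A.subalg S hS).carrier}, p = x ∨ p = z →
        p.1 ∈ A.ClosureSet {x.1, z.1} := by
      rintro p (rfl | rfl)
      · exact left_mem_closureSet _ _
      · exact hzmem
    refine hmin z.1 ⟨z, hz, rfl⟩ hzmem _ ⟨t.eval (A.subalg S hS) ![p, q, r], ?_, ?_⟩
      ((A.closureSet_isClosed _).eval₃ t (hmem hp) (hmem hq) (hmem hr))
    · exact (hφ.eval₃ t p q r).trans h
    · exact (isHom_val A S hS).eval₃ t p q r
  refine ⟨z, hz, fun t ht => ?_⟩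
  have h := hmaj t ht (φ y) (by simp) (φ x) (by simp)
  rw [← hz] at h
  exact ⟨hstep t x z z (.inl rfl) (.inr rfl) (.inr rfl) (h.2.2.trans hz),
    hstep t z x z (.inr rfl) (.inl rfl) (.inr rfl) (h.2.1.trans hz),
    hstep t z z x (.inr rfl) (.inr rfl) (.inl rfl) (h.1.trans hz)⟩

theorem _root_.MinorityCondition.eval_idempotent {t : Term σ 3}
    (ht : MinorityCondition A.QuotSub t) (x y : A.carrier) :
    t.eval A ![t.eval A ![x, y, y], y, y] = t.eval A ![x, y, y] := by
  have huniv : A.IsClosed Set.univ := fun _ _ _ => trivial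
  have hval := isHom_val A Set.univ huniv
  obtain ⟨e, he, -⟩ := hval.exists_equiv_quot_ker fun x => ⟨⟨x, trivial⟩, rfl⟩
  obtain ⟨x, rfl⟩ := e.surjective x
  obtain ⟨y, rfl⟩ := e.surjective y
  rw [← he.eval₃, ← he.eval₃]
  exact congrArg e (ht.1 _ ⟨_, huniv, _, rfl⟩ x y)

theorem exists_isThinAffEdge (hA : Finite A.carrier) (hid : A.Idempotent)
    (hφ : IsHom (A.subalg S hS) Q φ) (x y : (A.subalg S hS).carrier)
    (hmin : ∀ t, MinorityCondition A.QuotSub t →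
      IsMaltsevOn (fun u v w => t.eval Q ![u, v, w]) {φ x, φ y}) :
    ∃ z, φ z = φ y ∧ IsThinAffEdge A.QuotSub A x.1 z.1 := by
  obtain ⟨_, ⟨u, hu, rfl⟩, hclosure⟩ := exists_closureSet_minimal hA x.1
    (D := Subtype.val '' {z | φ z = φ y}) ⟨y.1, y, rfl, rfl⟩
  obtain ⟨h, hh⟩ := exists_minorityCondition hA hid
  have hval := isHom_val A S hS
  obtain ⟨z, hz⟩ : ∃ z, z = h.eval (A.subalg S hS) ![u, x, x] := ⟨_, rfl⟩
  have hzval : z.1 = h.eval A ![u.1, x.1, x.1] := by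
    rw [hz]
    exact hval.eval₃ h u x x
  have hzy : φ z = φ y := by
    rw [hz]
    refine (hφ.eval₃ h u x x).trans ?_
    rw [show φ u = φ y from hu]
    exact (hmin h hh (φ y) (by simp) (φ x) (by simp)).1
  refine ⟨z, hzy, ⟨h, hh, ?_⟩, fun t ht => ?_⟩
  · rw [hzval]
    exact hh.eval_idempotent _ _
  · refine hclosure z.1 ⟨z, hzy, rfl⟩ ?_ _ ⟨t.eval (A.subalg S hS) ![x, x, z], ?_, ?_⟩ ?_
    · rw [hzval]
      exact (A.closureSet_isClosed _).eval₃ h (right_mem_closureSet _ _) (left_mem_closureSet _ _)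
        (left_mem_closureSet _ _)
    · change φ _ = φ y
      rw [hφ.eval₃, hzy]
      exact (hmin t ht (φ y) (by simp) (φ x) (by simp)).2
    · exact hval.eval₃ t x x z
    · exact (A.closureSet_isClosed _).eval₃ t (left_mem_closureSet _ _) (left_mem_closureSet _ _)
        (right_mem_closureSet _ _)

end

theorem isHom_sg_inclusion {S : Set A.carrier} (hS : A.IsClosed S) (x y : (A.subalg S hS).carrier) :
    IsHom (A.Sg {x.1, y.1}) (A.subalg S hS)
      fun z => ⟨z.1, closureSet_pair_subset hS x.2 y.2 z.2⟩ := fun _ _ => rfl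

theorem thinReach_of_mem (hA : Finite A.carrier) (hid : A.Idempotent) (h1 : A.OmitsType1)
    (hsf : A.SemilatticeFree) {S : Set A.carrier} (hS : A.IsClosed S)
    (ih : ∀ U : Set A.carrier, U ⊂ S → A.IsClosed U → ∀ x ∈ U, ∀ y ∈ U, A.ThinReach x y)
    (a b : (A.subalg S hS).carrier) : A.ThinReach a.1 b.1 := by
  by_contra hab
  have hne : a ≠ b := fun heq => hab (heq ▸ .refl)
  obtain ⟨θ, hθ⟩ := exists_isMaximal (finite_subalg hA S hS) hne
  obtain ⟨Q, hQ⟩ : ∃ Q, Q = (A.subalg S hS).quot θ := ⟨_, rfl⟩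
  have hQmem : Q ∈ A.QuotSub := ⟨S, hS, θ, hQ⟩
  have hsimple : Q.IsSimple := hQ ▸ hθ.isSimple_quot
  have hQid : Q.Idempotent := hQ ▸ (hid.subalg S hS).quot θ
  have hQfin : Finite Q.carrier := hQ ▸ finite_quot (finite_subalg hA S hS) θ
  obtain ⟨φ, hφ, hsurj, hker⟩ : ∃ φ : (A.subalg S hS).carrier → Q.carrier,
      IsHom (A.subalg S hS) Q φ ∧ Function.Surjective φ ∧ ∃ x y, φ x ≠ φ y := by
    obtain ⟨x, y, hxy⟩ : ∃ x y, ¬ θ.rel x y := by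
      by_contra! h
      exact hθ.1 h
    subst hQ
    exact ⟨Quotient.mk θ.toSetoid, isHom_mk θ, Quotient.mk_surjective, x, y,
      fun h => hxy (Quotient.exact h)⟩
  clear hQ hθ
  have hproper : ∀ U, Q.IsClosed U → U ≠ Set.univ → ∀ x y, φ x ∈ U → φ y ∈ U →
      A.ThinReach x.1 y.1 := by
    intro U hU hne x y hx hy
    refine ih (Subtype.val '' (φ ⁻¹' U)) ⟨?_, fun hsub => hne ?_⟩ ?_ _ ⟨x, hx, rfl⟩ _ ⟨y, hy, rfl⟩
    · rintro _ ⟨z, -, rfl⟩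
      exact z.2
    · refine Set.eq_univ_of_forall fun u => ?_
      obtain ⟨z, rfl⟩ := hsurj u
      obtain ⟨w, hw, hwz⟩ := hsub z.2
      rwa [← Subtype.ext hwz]
    · intro f v hv
      choose w hw hwv using hv
      refine ⟨(A.subalg S hS).interp f w, hU.preimage hφ f w hw, ?_⟩
      rw [← funext hwv]
      rfl
  have hclass : ∀ x y, φ x = φ y → A.ThinReach x.1 y.1 := by
    intro x y hxy
    refine hproper {φ x} (fun f v hv => ?_) (fun huniv => ?_) x y rfl hxy.symm
    · rw [funext hv]
      exact hQid f _
    · obtain ⟨u, v, huv⟩ := hker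
      have hu : φ u ∈ ({φ x} : Set Q.carrier) := huniv ▸ Set.mem_univ _
      have hv : φ v ∈ ({φ x} : Set Q.carrier) := huniv ▸ Set.mem_univ _
      exact huv (hu.trans hv.symm)
  let E : Q.carrier → Q.carrier → Prop := fun u v =>
    ∀ x y, φ x = u → φ y = v → A.ThinReach x.1 y.1 ∧ A.ThinReach y.1 x.1
  have hEquiv : Equivalence E := by
    refine ⟨fun u x y hx hy => ?_, fun h x y hx hy => (h y x hy hx).symm,
      fun {u v w} h h' x z hx hz => ?_⟩
    · exact ⟨hclass _ _ (hx.trans hy.symm), hclass _ _ (hy.trans hx.symm)⟩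
    · obtain ⟨y, hy⟩ := hsurj v
      exact ⟨(h x y hx hy).1.trans (h' y z hy hz).1, (h' y z hy hz).2.trans (h x y hx hy).2⟩
  have hgen : ∀ c d, ¬ E c d → ∀ U, Q.IsClosed U → c ∈ U → d ∈ U → ∀ x, x ∈ U := by
    intro c d hcd U hU hc hd
    by_contra! hx
    obtain ⟨x, hx⟩ := hx
    have hne : U ≠ Set.univ := fun h => hx (h ▸ Set.mem_univ x)
    refine hcd fun x y hx hy => ?_
    subst hx hy
    exact ⟨hproper U hU hne x y hc hd, hproper U hU hne y x hd hc⟩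
  have hdistinct : ∀ {c d}, ¬ E c d → c ≠ d := fun hcd heq => hcd (heq ▸ hEquiv.refl _)
  have hnosl : ∀ c d, ¬ E c d →
      ¬ ∃ s : Term σ 2, IsSemilatticeOn (fun u v => s.eval Q ![u, v]) {c, d} := by
    intro c d hcd
    obtain ⟨x, rfl⟩ := hsurj c
    obtain ⟨y, rfl⟩ := hsurj d
    have hψ := hφ.comp (isHom_sg_inclusion hS x y)
    exact hsf.not_isSemilatticeOn hψ (hgen _ _ hcd _ hψ.isClosed_range ⟨A.sgA x.1 y.1, rfl⟩
      ⟨A.sgB x.1 y.1, rfl⟩) hsimple (hdistinct hcd)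
  have hclos : ∀ c d, ¬ E c d → Q.ClosureSet {c, d} = Set.univ := fun c d hcd =>
    Set.eq_univ_of_forall (hgen c d hcd _ (Q.closureSet_isClosed _) (left_mem_closureSet c d)
      (right_mem_closureSet c d))
  have hmaj : ∀ x y, ¬ E (φ x) (φ y) →
      (∃ s : Term σ 3, IsMajorityOn (fun u v w => s.eval Q ![u, v, w]) {φ x, φ y}) →
      A.ThinReach x.1 y.1 := by
    intro x y hxy hs
    obtain ⟨z, hz, hxz⟩ := exists_isThinMajEdge hA hφ x y fun t ht =>
      ht.isMajorityOn hQmem hsimple (hclos _ _ hxy) (hdistinct hxy) hs (hnosl _ _ hxy)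
    exact .head (.inr hxz) (hclass z y hz)
  have hE : ¬ E (φ a) (φ b) := fun h => hab (h a b rfl rfl).1
  have huntyped : Untyped Q E := by
    refine ⟨hQfin, hQid, hsimple, hEquiv, ⟨_, _, hE⟩, hgen, ?_, ?_⟩
    · rintro c d hcd ⟨s, hs, hs'⟩
      refine hnosl c d hcd ⟨s, ?_⟩
      have hc := Term.eval_const₂ hQid s c
      have hd := Term.eval_const₂ hQid s d
      simp [IsSemilatticeOn, hs, hs', hc, hd]
    · rintro c d hcd ⟨t, ⟨h₁, h₂, h₃⟩, h₄, h₅, h₆⟩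
      have hc := Term.eval_const₃ hQid t c
      have hd := Term.eval_const₃ hQid t d
      have ht : IsMajorityOn (fun u v w => t.eval Q ![u, v, w]) {c, d} := by
        simp [IsMajorityOn, h₁, h₂, h₃, h₄, h₅, h₆, hc, hd]
      refine hcd fun x y hx hy => ?_
      subst hx hy
      refine ⟨hmaj x y hcd ⟨t, ht⟩, hmaj y x (fun h => hcd (hEquiv.symm h)) ⟨t, ?_⟩⟩
      rwa [Set.pair_comm]
  have hset : ¬ Q.IsSetAlgebra := fun hset => by
    have hψ := hφ.comp (isHom_val (A.subalg S hS) _ (closureSet_isClosed _ {a, b}))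
    refine h1 S hS a b (hset.isUnaryEdge hψ (hgen _ _ hE _ hψ.isClosed_range
      ⟨(A.subalg S hS).sgA a b, rfl⟩ ⟨(A.subalg S hS).sgB a b, rfl⟩) hsimple (hdistinct hE))
  obtain ⟨z, hz, haz⟩ := exists_isThinAffEdge hA hid hφ a b fun t ht =>
    ht.isMaltsevOn hQmem hsimple (hclos _ _ hE) (hdistinct hE) (huntyped.isAffineAlgebra hset)
  exact hab (.head (.inl haz) (hclass z b hz))

theorem thinReach (hA : Finite A.carrier) (hid : A.Idempotent) (h1 : A.OmitsType1)
    (hsf : A.SemilatticeFree) (a b : A.carrier) : A.ThinReach a b := by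
  have h : ∀ S : Set A.carrier, A.IsClosed S → ∀ x ∈ S, ∀ y ∈ S, A.ThinReach x y := fun S =>
    WellFoundedLT.induction (motive := fun S : Set A.carrier =>
      A.IsClosed S → ∀ x ∈ S, ∀ y ∈ S, A.ThinReach x y) S fun S ih hS x hx y hy =>
        thinReach_of_mem hA hid h1 hsf hS ih ⟨x, hx⟩ ⟨y, hy⟩
  exact h Set.univ (fun _ _ _ => trivial) a trivial b trivial

end UAlgebra

theorem Relation.ReflTransGen.exists_nat_path {α : Type*} {r : α → α → Prop} {a b : α}
    (h : Relation.ReflTransGen r a b) :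
    ∃ (k : ℕ) (c : ℕ → α), c 0 = a ∧ c k = b ∧ ∀ i < k, r (c i) (c (i + 1)) := by
  induction h using Relation.ReflTransGen.head_induction_on with
  | refl => exact ⟨0, fun _ => b, rfl, rfl, by simp⟩
  | @head u v huv _ ih =>
    obtain ⟨k, p, h₀, hk, hp⟩ := ih
    refine ⟨k + 1, fun n => Nat.casesOn n u p, rfl, hk, fun i hi => ?_⟩
    cases i with
    | zero => simpa [h₀] using huv
    | succ i => exact hp i (by omega)

/-- in a smooth semilattice free finite idempotent algebra
omitting type 1, any two elements are connected by a directed path of thin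
affine and thin majority edges. -/
theorem stmt_3 (σ : Signature) (A : UAlgebra σ)
    (hfin : Finite A.carrier) (hne : Nonempty A.carrier) (hid : A.Idempotent)
    (h1 : A.OmitsType1) (hsm : A.IsSmooth) (hsf : A.SemilatticeFree)
    (a b : A.carrier) :
    ∃ (k : ℕ) (c : ℕ → A.carrier), c 0 = a ∧ c k = b ∧
      ∀ i < k, IsThinAffEdge (UAlgebra.QuotSub A) A (c i) (c (i + 1)) ∨
        IsThinMajEdge (UAlgebra.QuotSub A) A (c i) (c (i + 1)) := by
  exact (UAlgebra.thinReach hfin hid h1 hsf a b).exists_nat_path
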